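/- arXiv:1111.5448 — 3 statements merged into one kernel-verified Lean document; each statement's English description precedes it below -/
import Mathlib

section
/- Let (T, F) be a torsion theory in a homological category A satisfying conditions (P) and (N). Then: (1) the full subcategory NExt_F(A) of the arrow category of A determined by the normal extensions with respect to the reflection F : A → F is reflective in the full subcategory EffDes(A) determined by the effective descent morphisms; (2) the composite of two normal extensions is a normal extension; (3) every effective descent morphism f : A → B factors, uniquely up to isomorphism, as f = m ∘ e where every pullback of e is inverted by F and m is a normal extension, and this factorisation coincides with the (Ē, M̄)-factorisation of f. -/
open CategoryTheory CategoryTheory.Limits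

universe v u v₂ u₂

namespace ProtoPaper

variable {C : Type u} [Category.{v} C]

section ZeroDefs

variable [HasZeroMorphisms C]

/-- `k` is a kernel of `f`. -/
def IsKernelOf {K A B : C} (k : K ⟶ A) (f : A ⟶ B) : Prop :=
  ∃ w : k ≫ f = 0, Nonempty (IsLimit (KernelFork.ofι k w))

/-- `f` is a cokernel of `k`. -/
def IsCokernelOf {K A B : C} (f : A ⟶ B) (k : K ⟶ A) : Prop :=
  ∃ w : k ≫ f = 0, Nonempty (IsColimit (CokernelCofork.ofπ f w))

/-- A normal monomorphism: a kernel of some morphism. -/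
def IsNormalMonoArrow {K A : C} (k : K ⟶ A) : Prop :=
  ∃ (B : C) (f : A ⟶ B), IsKernelOf k f

/-- A normal epimorphism: a cokernel of some morphism. -/
def IsNormalEpiArrow {A B : C} (f : A ⟶ B) : Prop :=
  ∃ (K : C) (k : K ⟶ A), IsCokernelOf f k

/-- A split short exact sequence `0 → K → A ⇄ B → 0`. -/
structure IsSplitShortExact {K A B : C} (k : K ⟶ A) (f : A ⟶ B) (s : B ⟶ A) : Prop where
  isKernel : IsKernelOf k f
  split : s ≫ f = 𝟙 B

/-- A short exact sequence `0 → K → A → B → 0`. -/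
structure IsShortExact {K A B : C} (k : K ⟶ A) (f : A ⟶ B) : Prop where
  isKernel : IsKernelOf k f
  isCokernel : IsCokernelOf f k

/-- A protosplit monomorphism: a kernel of a split epimorphism. -/
def IsProtosplitMono {K A : C} (k : K ⟶ A) : Prop :=
  ∃ (B : C) (f : A ⟶ B) (s : B ⟶ A), IsSplitShortExact k f s

end ZeroDefs

/-- A pointed category is protomodular when the split short five lemma holds. -/
def IsProtomodular (C : Type u) [Category.{v} C] [HasZeroMorphisms C] : Prop :=
  ∀ ⦃K A B K' A' B' : C⦄ (k : K ⟶ A) (f : A ⟶ B) (s : B ⟶ A)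
    (k' : K' ⟶ A') (f' : A' ⟶ B') (s' : B' ⟶ A')
    (κ : K ⟶ K') (α : A ⟶ A') (β : B ⟶ B'),
    IsSplitShortExact k f s → IsSplitShortExact k' f' s' →
    k ≫ α = κ ≫ k' → f ≫ β = α ≫ f' → s ≫ α = β ≫ s' →
    IsIso κ → IsIso β → IsIso α

section Functors

variable {D : Type u₂} [Category.{v₂} D]

/-- A functor is protoadditive if it preserves split short exact sequences. -/
def IsProtoadditive [HasZeroMorphisms C] [HasZeroMorphisms D] (F : C ⥤ D) : Prop :=
  ∀ ⦃K A B : C⦄ (k : K ⟶ A) (f : A ⟶ B) (s : B ⟶ A),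
    IsSplitShortExact k f s → IsSplitShortExact (F.map k) (F.map f) (F.map s)

/-- A functor preserves zero objects. -/
def PreservesZeroObjects (F : C ⥤ D) : Prop :=
  ∀ X : C, IsZero X → IsZero (F.obj X)

/-- A functor preserves pullbacks along split epimorphisms. -/
def PreservesPullbacksAlongSplitEpis (F : C ⥤ D) : Prop :=
  ∀ ⦃P X Y Z : C⦄ (fst : P ⟶ X) (snd : P ⟶ Y) (f : X ⟶ Z) (g : Y ⟶ Z),
    IsSplitEpi f → IsPullback fst snd f g →
    IsPullback (F.map fst) (F.map snd) (F.map f) (F.map g)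

end Functors

/-- A homological category: pointed, protomodular and regular (finitely complete with
pullback-stable (regular epi, mono) factorisations). -/
structure IsHomological (C : Type u) [Category.{v} C] [HasZeroObject C]
    [HasZeroMorphisms C] : Prop where
  protomodular : IsProtomodular C
  hasFiniteLimits : HasFiniteLimits C
  regEpiMonoFac : ∀ ⦃X Y : C⦄ (f : X ⟶ Y),
    ∃ (I : C) (e : X ⟶ I) (m : I ⟶ Y), Nonempty (RegularEpi e) ∧ Mono m ∧ e ≫ m = f
  regEpiStable : ∀ ⦃P X Y Z : C⦄ (fst : P ⟶ X) (snd : P ⟶ Y) (f : X ⟶ Z) (g : Y ⟶ Z),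
    IsPullback fst snd f g → Nonempty (RegularEpi f) → Nonempty (RegularEpi snd)

/-- An internal equivalence relation, given by a jointly monic pair which is internally
reflexive, symmetric and transitive. -/
structure IsInternalEquivRel {R X : C} (p₁ p₂ : R ⟶ X) : Prop where
  jointlyMono : ∀ ⦃Z : C⦄ (a b : Z ⟶ R), a ≫ p₁ = b ≫ p₁ → a ≫ p₂ = b ≫ p₂ → a = b
  refl : ∃ d : X ⟶ R, d ≫ p₁ = 𝟙 X ∧ d ≫ p₂ = 𝟙 X
  symm : ∃ σ : R ⟶ R, σ ≫ p₁ = p₂ ∧ σ ≫ p₂ = p₁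
  trans : ∀ ⦃P : C⦄ (q₁ q₂ : P ⟶ R), IsPullback q₁ q₂ p₂ p₁ →
    ∃ t : P ⟶ R, t ≫ p₁ = q₁ ≫ p₁ ∧ t ≫ p₂ = q₂ ≫ p₂

/-- A semi-abelian category: homological, with binary coproducts, and exact
(every internal equivalence relation is a kernel pair). -/
structure IsSemiAbelian (C : Type u) [Category.{v} C] [HasZeroObject C]
    [HasZeroMorphisms C] : Prop where
  homological : IsHomological C
  hasBinaryCoproducts : HasBinaryCoproducts C
  equivRelEffective : ∀ ⦃R X : C⦄ (p₁ p₂ : R ⟶ X), IsInternalEquivRel p₁ p₂ →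
    ∃ (Y : C) (f : X ⟶ Y), IsPullback p₁ p₂ f f

/-- A full subcategory (given by a predicate on objects) is replete if it is closed
under isomorphisms. -/
def Replete (P : C → Prop) : Prop := ∀ ⦃X Y : C⦄, P X → (X ≅ Y) → P Y

/-- A reflection of `C` onto the full subcategory of objects satisfying `P`:
a reflector `F`, a unit `η`, landing in `P`, with the usual universal property. -/
structure Reflection (C : Type u) [Category.{v} C] (P : C → Prop) where
  F : C ⥤ C
  η : 𝟭 C ⟶ F
  mem : ∀ X : C, P (F.obj X)
  univ : ∀ ⦃X B : C⦄, P B → ∀ f : X ⟶ B, ∃! g : F.obj X ⟶ B, η.app X ≫ g = f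

variable {P : C → Prop}

/-- A (normal epi)-reflection: all units are normal epimorphisms. -/
def NormalEpiUnits [HasZeroMorphisms C] (R : Reflection C P) : Prop :=
  ∀ X : C, IsNormalEpiArrow (R.η.app X)

/-- `f` is a trivial extension with respect to the reflection `R`. -/
def IsTrivialExt (R : Reflection C P) {A B : C} (f : A ⟶ B) : Prop :=
  IsPullback (R.η.app A) f (R.F.map f) (R.η.app B)

/-- `p` is an effective descent morphism: the pullback functor between the slice
categories is monadic. -/
def IsEffectiveDescent [HasPullbacks C] {E B : C} (p : E ⟶ B) : Prop :=
  Nonempty (MonadicRightAdjoint (Over.pullback p))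

/-- A central extension with respect to the (absolute) Galois structure of a reflection:
some pullback along an effective descent morphism is a trivial extension. -/
def IsCentralExt [HasPullbacks C] (R : Reflection C P) {A B : C} (f : A ⟶ B) : Prop :=
  ∃ (E : C) (p : E ⟶ B), IsEffectiveDescent p ∧
    ∃ (Pb : C) (p1 : Pb ⟶ E) (p2 : Pb ⟶ A), IsPullback p1 p2 p f ∧ IsTrivialExt R p1

/-- A normal extension with respect to the (absolute) Galois structure of a reflection. -/
def IsNormalExt [HasPullbacks C] (R : Reflection C P) {A B : C} (f : A ⟶ B) : Prop :=
  IsEffectiveDescent f ∧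
    ∃ (Pb : C) (p1 p2 : Pb ⟶ A), IsPullback p1 p2 f f ∧ IsTrivialExt R p1

/-- A central extension with respect to the Galois structure of a reflection relative to
the class of normal epimorphisms. -/
def IsCentralExtN [HasZeroMorphisms C] (R : Reflection C P) {A B : C} (f : A ⟶ B) : Prop :=
  IsNormalEpiArrow f ∧ ∃ (E : C) (p : E ⟶ B), IsNormalEpiArrow p ∧
    ∃ (Pb : C) (p1 : Pb ⟶ E) (p2 : Pb ⟶ A), IsPullback p1 p2 p f ∧ IsTrivialExt R p1

/-- A normal extension with respect to the Galois structure of a reflection relative to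
the class of normal epimorphisms. -/
def IsNormalExtN [HasZeroMorphisms C] (R : Reflection C P) {A B : C} (f : A ⟶ B) : Prop :=
  IsNormalEpiArrow f ∧
    ∃ (Pb : C) (p1 p2 : Pb ⟶ A), IsPullback p1 p2 f f ∧ IsTrivialExt R p1

/-- The reflector is semi-left-exact: it preserves pullbacks of units along morphisms
with domain in the subcategory. -/
def SemiLeftExact (R : Reflection C P) : Prop :=
  ∀ ⦃A X Pb : C⦄ (x : X ⟶ R.F.obj A) (p1 : Pb ⟶ A) (p2 : Pb ⟶ X), P X →
    IsPullback p1 p2 (R.η.app A) x →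
    IsPullback (R.F.map p1) (R.F.map p2) (R.F.map (R.η.app A)) (R.F.map x)

/-- The reflector has stable units: it preserves pullbacks of units along arbitrary
morphisms. -/
def StableUnits (R : Reflection C P) : Prop :=
  ∀ ⦃A X Pb : C⦄ (x : X ⟶ R.F.obj A) (p1 : Pb ⟶ A) (p2 : Pb ⟶ X),
    IsPullback p1 p2 (R.η.app A) x →
    IsPullback (R.F.map p1) (R.F.map p2) (R.F.map (R.η.app A)) (R.F.map x)

/-- The reflection is admissible with respect to the class of normal epimorphisms:
the reflector preserves pullbacks of units along normal epimorphisms with domain in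
the subcategory. -/
def AdmissibleN [HasZeroMorphisms C] (R : Reflection C P) : Prop :=
  ∀ ⦃A X Pb : C⦄ (x : X ⟶ R.F.obj A) (p1 : Pb ⟶ A) (p2 : Pb ⟶ X), P X →
    IsNormalEpiArrow x →
    IsPullback p1 p2 (R.η.app A) x →
    IsPullback (R.F.map p1) (R.F.map p2) (R.F.map (R.η.app A)) (R.F.map x)

/-- The radical associated to a (normal epi)-reflection is idempotent. -/
def IdempotentRadical [HasZeroMorphisms C] (R : Reflection C P) : Prop :=
  ∀ ⦃A TA : C⦄ (t : TA ⟶ A), IsKernelOf t (R.η.app A) →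
    ∀ ⦃T2 : C⦄ (t2 : T2 ⟶ TA), IsKernelOf t2 (R.η.app TA) → IsIso t2

/-- Condition (N) for a (normal epi)-reflection: for any morphism `f` with kernel
`k : K ⟶ A`, and any kernel `t : TK ⟶ K` of the unit at `K`, the composite `t ≫ k`
is a normal monomorphism. -/
def ConditionN [HasZeroMorphisms C] (R : Reflection C P) : Prop :=
  ∀ ⦃A B : C⦄ (f : A ⟶ B) ⦃K : C⦄ (k : K ⟶ A), IsKernelOf k f →
    ∀ ⦃TK : C⦄ (t : TK ⟶ K), IsKernelOf t (R.η.app K) → IsNormalMonoArrow (t ≫ k)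

/-- A torsion theory on a pointed category, given by a pair of full replete
subcategories. -/
structure TorsionTheory (C : Type u) [Category.{v} C] [HasZeroMorphisms C]
    (T F : C → Prop) : Prop where
  repleteT : Replete T
  repleteF : Replete F
  hom_zero : ∀ ⦃X Y : C⦄ (f : X ⟶ Y), T X → F Y → f = 0
  exists_ses : ∀ A : C, ∃ (TA FA : C) (t : TA ⟶ A) (q : A ⟶ FA),
    T TA ∧ F FA ∧ IsShortExact t q

/-- Condition (N) for a torsion theory, formulated without reference to a chosen
reflector: for any morphism `f` with kernel `k : K ⟶ A` and any short exact sequence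
`0 → TK → K → FK → 0` with `TK` torsion and `FK` torsion-free, the composite
`TK → A` is a normal monomorphism. -/
def TTConditionN [HasZeroMorphisms C] (T F : C → Prop) : Prop :=
  ∀ ⦃A B K TK FK : C⦄ (f : A ⟶ B) (k : K ⟶ A) (t : TK ⟶ K) (q : K ⟶ FK),
    IsKernelOf k f → T TK → F FK → IsShortExact t q → IsNormalMonoArrow (t ≫ k)

/-- Condition (P) for a torsion theory: the torsion-free reflector is protoadditive
(formulated for every (normal epi)-reflection onto the torsion-free part). -/
def TTConditionP [HasZeroMorphisms C] (T F : C → Prop) : Prop :=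
  ∀ R : Reflection C F, NormalEpiUnits R → IsProtoadditive R.F

/-- Orthogonality `e ↓ m` of two morphisms. -/
def Orthogonal {A B X Y : C} (e : A ⟶ B) (m : X ⟶ Y) : Prop :=
  ∀ (a : A ⟶ X) (b : B ⟶ Y), e ≫ b = a ≫ m →
    ∃! d : B ⟶ X, e ≫ d = a ∧ d ≫ m = b

/-- The class of morphisms orthogonal on the right to all members of `E`. -/
def dnOrth (E : MorphismProperty C) : MorphismProperty C :=
  fun _ _ m => ∀ ⦃A B : C⦄ (e : A ⟶ B), E e → Orthogonal e m

/-- The class of morphisms orthogonal on the left to all members of `M`. -/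
def upOrth (M : MorphismProperty C) : MorphismProperty C :=
  fun _ _ e => ∀ ⦃X Y : C⦄ (m : X ⟶ Y), M m → Orthogonal e m

/-- A prefactorisation system. -/
structure IsPrefactorisationSystem (E M : MorphismProperty C) : Prop where
  E_eq : E = upOrth M
  M_eq : M = dnOrth E

/-- A factorisation system. -/
structure IsFactorisationSystem (E M : MorphismProperty C) : Prop where
  E_eq : E = upOrth M
  M_eq : M = dnOrth E
  fac : ∀ ⦃X Y : C⦄ (f : X ⟶ Y),
    ∃ (I : C) (e : X ⟶ I) (m : I ⟶ Y), E e ∧ M m ∧ e ≫ m = f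

/-- A pullback-stable class of morphisms. -/
def PullbackStable (E : MorphismProperty C) : Prop :=
  ∀ ⦃P X Y Z : C⦄ (fst : P ⟶ X) (snd : P ⟶ Y) (f : X ⟶ Z) (g : Y ⟶ Z),
    IsPullback fst snd f g → E f → E snd

/-- The class of morphisms inverted by the reflector. -/
def invertedByR (R : Reflection C P) : MorphismProperty C :=
  fun _ _ f => IsIso (R.F.map f)

/-- The class of morphisms all of whose pullbacks lie in `E` ("stably in `E`"). -/
def StablyIn (E : MorphismProperty C) : MorphismProperty C :=
  fun _ Y e => ∀ ⦃Pb W : C⦄ (fst : Pb ⟶ W) (snd : Pb ⟶ _) (g : W ⟶ Y),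
    IsPullback fst snd g e → E fst

/-- The class of morphisms locally in `M`: some pullback along an effective descent
morphism lies in `M`. -/
def locallyIn [HasPullbacks C] (M : MorphismProperty C) : MorphismProperty C :=
  fun _ B f => ∃ (E : C) (p : E ⟶ B), IsEffectiveDescent p ∧
    ∃ (Pb : C) (p1 : Pb ⟶ E) (p2 : Pb ⟶ _), IsPullback p1 p2 p f ∧ M p1

/-- The class `Ē` associated to a torsion theory: normal epimorphisms with torsion
kernel. -/
def Ebar [HasZeroMorphisms C] (T : C → Prop) : MorphismProperty C :=
  fun X _ e => IsNormalEpiArrow e ∧ ∃ (K : C) (k : K ⟶ X), IsKernelOf k e ∧ T K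

/-- The class `M̄` associated to a torsion theory: morphisms with torsion-free
kernel. -/
def Mbar [HasZeroMorphisms C] (F : C → Prop) : MorphismProperty C :=
  fun X _ m => ∃ (K : C) (k : K ⟶ X), IsKernelOf k m ∧ F K

/-- A Birkhoff subcategory: a (regular epi)-reflective subcategory such that the
naturality squares of the unit at regular epimorphisms are pushouts. -/
structure IsBirkhoff [HasZeroMorphisms C] (R : Reflection C P) : Prop where
  units_regEpi : ∀ X : C, Nonempty (RegularEpi (R.η.app X))
  pushout_units : ∀ ⦃A B : C⦄ (f : A ⟶ B), Nonempty (RegularEpi f) →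
    IsPushout f (R.η.app A) (R.η.app B) (R.F.map f)

section ArrowInstances

variable [HasZeroMorphisms C]

instance instZeroArrowHom (f g : Arrow C) : Zero (f ⟶ g) :=
  ⟨{ left := 0, right := 0, w := by simp }⟩

@[simp] lemma arrowHomZero_left (f g : Arrow C) : (0 : f ⟶ g).left = 0 := rfl

@[simp] lemma arrowHomZero_right (f g : Arrow C) : (0 : f ⟶ g).right = 0 := rfl

instance instArrowHasZeroMorphisms : HasZeroMorphisms (Arrow C) where
  comp_zero {X Y} f Z := by
    apply CommaMorphism.ext <;> simp
  zero_comp X {Y Z} f := by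
    apply CommaMorphism.ext <;> simp

end ArrowInstances




section RegularHelpers

variable [HasZeroObject C] [HasZeroMorphisms C]

lemma strongEpi_of_re {X Y : C} {f : X ⟶ Y} (h : Nonempty (RegularEpi f)) : StrongEpi f := by
  have : IsRegularEpi f := ⟨h⟩
  infer_instance

lemma IsHomological.re_of_strongEpi (hC : IsHomological C) {X Y : C} (f : X ⟶ Y) [StrongEpi f] :
    Nonempty (RegularEpi f) := by
  obtain ⟨I, e, m, ⟨he⟩, hm, fac⟩ := hC.regEpiMonoFac f
  have : StrongEpi (e ≫ m) := by rw [fac]; infer_instance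
  have : StrongEpi m := strongEpi_of_strongEpi e m
  have : IsIso m := isIso_of_mono_of_strongEpi m
  have i : Arrow.mk e ≅ Arrow.mk f :=
    Arrow.isoMk' e f (Iso.refl _) (asIso m) (by simp [fac])
  exact ⟨RegularEpi.ofArrowIso i he⟩

lemma IsHomological.strongEpi_snd (hC : IsHomological C) {P X Y Z : C} {fst : P ⟶ X} {snd : P ⟶ Y}
    {f : X ⟶ Z} {g : Y ⟶ Z} (h : IsPullback fst snd f g) [StrongEpi f] : StrongEpi snd :=
  strongEpi_of_re (hC.regEpiStable _ _ _ _ h (hC.re_of_strongEpi f))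

lemma IsHomological.strongEpi_fst (hC : IsHomological C) {P X Y Z : C} {fst : P ⟶ X} {snd : P ⟶ Y}
    {f : X ⟶ Z} {g : Y ⟶ Z} (h : IsPullback fst snd f g) [StrongEpi g] : StrongEpi fst :=
  hC.strongEpi_snd h.flip

lemma IsHomological.desc (hC : IsHomological C) {X Y Z : C} (f : X ⟶ Y) [StrongEpi f] (h : X ⟶ Z)
    (w : ∀ ⦃S : C⦄ (a b : S ⟶ X), a ≫ f = b ≫ f → a ≫ h = b ≫ h) :
    ∃ l : Y ⟶ Z, f ≫ l = h := by
  obtain ⟨r⟩ := hC.re_of_strongEpi f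
  obtain ⟨l, hl⟩ := r.desc' h (w _ _ r.w)
  exact ⟨l, hl⟩

/-- A morphism with the local lifting property is a strong epimorphism. -/
lemma IsHomological.strongEpi_of_local (_hC : IsHomological C) {X Y S : C} (f : X ⟶ Y)
    (s : S ⟶ Y) [StrongEpi s] (l : S ⟶ X) (h : l ≫ f = s) : StrongEpi f := by
  subst h
  exact strongEpi_of_strongEpi l f

end RegularHelpers

/-- Descent data, in generalized elements. -/
structure Act {E B X : C} (p : E ⟶ B) (c : X ⟶ E) where
  act : ∀ {S : C} (e : S ⟶ E) (x : S ⟶ X), e ≫ p = x ≫ c ≫ p → (S ⟶ X)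
  nat : ∀ {S S' : C} (s : S' ⟶ S) (e : S ⟶ E) (x : S ⟶ X) (h : e ≫ p = x ≫ c ≫ p),
    s ≫ act e x h = act (s ≫ e) (s ≫ x) (by simp [h])
  act_c : ∀ {S : C} (e : S ⟶ E) (x : S ⟶ X) (h : e ≫ p = x ≫ c ≫ p), act e x h ≫ c = e
  unit : ∀ {S : C} (x : S ⟶ X), act (x ≫ c) x (by simp) = x
  assoc : ∀ {S : C} (e e' : S ⟶ E) (x : S ⟶ X) (h : e ≫ p = x ≫ c ≫ p)
    (h' : e' ≫ p = x ≫ c ≫ p),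
    act e (act e' x h') (by rw [← Category.assoc, act_c, h, h']) = act e x h

/-- Elementary effectivity of all descent data. -/
def ActEff {E B : C} (p : E ⟶ B) : Prop :=
  ∀ ⦃X : C⦄ (c : X ⟶ E) (ξ : Act p c), ∃ (Z : C) (z : Z ⟶ B) (q : X ⟶ Z),
    IsPullback c q p z ∧ ∀ ⦃S : C⦄ (e : S ⟶ E) (x : S ⟶ X) (h : e ≫ p = x ≫ c ≫ p),
      ξ.act e x h ≫ q = x ≫ q

lemma Act.congr {E B X : C} {p : E ⟶ B} {c : X ⟶ E} (ξ : Act p c) {S : C} {e e' : S ⟶ E}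
    {x x' : S ⟶ X} (he : e = e') (hx : x = x') (h : e ≫ p = x ≫ c ≫ p) :
    ξ.act e x h = ξ.act e' x' (by rw [← he, ← hx, h]) := by
  subst he hx; rfl

section EDComp

variable [HasZeroObject C] [HasZeroMorphisms C] [HasPullbacks C]

lemma comp_lift' {S S' X Y Z : C} (s : S' ⟶ S) {f : X ⟶ Z} {g : Y ⟶ Z} (a : S ⟶ X) (b : S ⟶ Y)
    (h : a ≫ f = b ≫ g) :
    s ≫ pullback.lift a b h = pullback.lift (s ≫ a) (s ≫ b) (by simp [h]) := by
  apply pullback.hom_ext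
  · rw [Category.assoc, pullback.lift_fst, pullback.lift_fst]
  · rw [Category.assoc, pullback.lift_snd, pullback.lift_snd]

lemma ActEff.comp (hC : IsHomological C) {A B D : C} {f : A ⟶ B} {g : B ⟶ D}
    [StrongEpi f] (hf : ActEff f) (hg : ActEff g) :
    ActEff (f ≫ g) := by
  intro X c ξ
  let ξf : Act f c :=
    { act := fun e x h => ξ.act e x (by simp only [← Category.assoc] at h ⊢; rw [h])
      nat := fun s e x h => ξ.nat s e x _
      act_c := fun e x h => ξ.act_c e x _
      unit := fun x => ξ.unit x
      assoc := fun e e' x h h' => ξ.assoc e e' x _ _ }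
  obtain ⟨Y, y, q, hq, hqa⟩ := hf c ξf
  have hqa' : ∀ ⦃S : C⦄ (e : S ⟶ A) (x : S ⟶ X) (h : e ≫ f = x ≫ c ≫ f)
    (h' : e ≫ f ≫ g = x ≫ c ≫ f ≫ g),
      ξ.act e x h' ≫ q = x ≫ q := fun S e x h h' => hqa e x h
  have : StrongEpi q := hC.strongEpi_snd hq
  have wd : ∀ ⦃S : C⦄ (a a' : S ⟶ A) (x x' : S ⟶ X) (h : a ≫ f ≫ g = x ≫ c ≫ f ≫ g)
      (h' : a' ≫ f ≫ g = x' ≫ c ≫ f ≫ g), a ≫ f = a' ≫ f → x ≫ q = x' ≫ q →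
      ξ.act a x h ≫ q = ξ.act a' x' h' ≫ q := by
    intro S a a' x x' h h' ha hx
    have hcx : (x' ≫ c) ≫ f = x ≫ c ≫ f := by
      rw [Category.assoc, hq.w, reassoc_of% hx]
    have hcx' : (x' ≫ c) ≫ f ≫ g = x ≫ c ≫ f ≫ g := by
      simpa using congrArg (· ≫ g) hcx
    have e1 : x' = ξ.act (x' ≫ c) x hcx' := by
      apply hq.hom_ext
      · rw [ξ.act_c]
      · rw [hqa' _ _ hcx, hx]
    have h'' : a' ≫ f ≫ g = x ≫ c ≫ f ≫ g := by
      rw [h']; simpa using hcx'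
    have e2 : ξ.act a' x' h' = ξ.act a' x h'' := by
      rw [← ξ.assoc a' (x' ≫ c) x h'' hcx']
      exact ξ.congr rfl e1 _
    have e3 : ξ.act a' x h'' = ξ.act a' (ξ.act a x h)
        (by rw [← Category.assoc (ξ.act a x h), ξ.act_c, h, h'']) :=
      (ξ.assoc a' a x h'' h).symm
    rw [e2, e3]
    symm
    apply hqa'
    rw [← Category.assoc (ξ.act a x h), ξ.act_c, ha]
  have cover : ∀ ⦃S : C⦄ (b : S ⟶ B) (w : S ⟶ Y), ∃ (S' : C) (s : S' ⟶ S) (a : S' ⟶ A)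
      (x : S' ⟶ X), StrongEpi s ∧ a ≫ f = s ≫ b ∧ x ≫ q = s ≫ w := by
    intro S b w
    have h1 := hC.strongEpi_snd (IsPullback.of_hasPullback f b)
    have h2 := hC.strongEpi_snd (IsPullback.of_hasPullback q (pullback.snd f b ≫ w))
    refine ⟨_, pullback.snd q (pullback.snd f b ≫ w) ≫ pullback.snd f b,
      pullback.snd q (pullback.snd f b ≫ w) ≫ pullback.fst f b,
      pullback.fst q (pullback.snd f b ≫ w), inferInstance, ?_, ?_⟩
    · simp [pullback.condition]
    · simp [pullback.condition]
  let π₁ := pullback.fst g (y ≫ g)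
  let π₂ := pullback.snd g (y ≫ g)
  have hπ : π₁ ≫ g = π₂ ≫ y ≫ g := pullback.condition
  obtain ⟨S, s, a, x, hs, ha, hx⟩ := cover π₁ π₂
  have hax : a ≫ f ≫ g = x ≫ c ≫ f ≫ g := by
    rw [hq.w_assoc, reassoc_of% ha, reassoc_of% hx, hπ]
  obtain ⟨θ, hθ⟩ := hC.desc s (ξ.act a x hax ≫ q) (by
    intro S' u v huv
    rw [← Category.assoc, ← Category.assoc, ξ.nat, ξ.nat]
    apply wd
    · rw [Category.assoc, Category.assoc, ha, reassoc_of% huv]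
    · rw [Category.assoc, Category.assoc, hx, reassoc_of% huv])
  have key : ∀ ⦃S' : C⦄ (a' : S' ⟶ A) (x' : S' ⟶ X) (b : S' ⟶ B) (w : S' ⟶ Y)
      (h : a' ≫ f ≫ g = x' ≫ c ≫ f ≫ g) (hb : b = a' ≫ f) (hw : w = x' ≫ q)
      (h' : b ≫ g = w ≫ y ≫ g),
      pullback.lift b w h' ≫ θ = ξ.act a' x' h ≫ q := by
    intro S' a' x' b w h hb hw h'
    have h2 := hC.strongEpi_snd (IsPullback.of_hasPullback s (pullback.lift b w h'))
    rw [← cancel_epi (pullback.snd s (pullback.lift b w h')), ← pullback.condition_assoc, hθ,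
      ← Category.assoc, ← Category.assoc, ξ.nat, ξ.nat]
    apply wd
    · rw [Category.assoc, Category.assoc, ha, pullback.condition_assoc, pullback.lift_fst, ← hb]
    · rw [Category.assoc, Category.assoc, hx, pullback.condition_assoc, pullback.lift_snd, ← hw]
  have qy : ∀ ⦃S' : C⦄ (x' : S' ⟶ X), x' ≫ q ≫ y = x' ≫ c ≫ f := by
    intro S' x'; rw [hq.w]
  let ζ : Act g y :=
    { act := fun b w h => pullback.lift b w h ≫ θ
      nat := fun s e x h => by
        rw [← Category.assoc, comp_lift']
      act_c := fun b w h => by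
        obtain ⟨S', s', a', x', hs', ha', hx'⟩ := cover b w
        have hh : a' ≫ f ≫ g = x' ≫ c ≫ f ≫ g := by
          rw [hq.w_assoc, reassoc_of% ha', reassoc_of% hx', h]
        rw [← cancel_epi s', ← Category.assoc, ← Category.assoc,
          comp_lift',
          key a' x' _ _ hh ha'.symm hx'.symm, Category.assoc, ← hq.w, ← Category.assoc, ξ.act_c, ha']
      unit := fun w => by
        obtain ⟨S', s', a', x', hs', ha', hx'⟩ := cover (w ≫ y) w
        rw [← cancel_epi s', ← Category.assoc,
          comp_lift',
          key (x' ≫ c) x' _ _ (by simp) (by rw [Category.assoc, ← qy, reassoc_of% hx']) hx'.symm,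
          ξ.unit, hx']
      assoc := fun b b' w h h' => by
        obtain ⟨S', s', a', x', hs', ha', hx'⟩ := cover b' w
        have h3 := hC.strongEpi_snd (IsPullback.of_hasPullback f (s' ≫ b))
        let t := pullback.snd f (s' ≫ b)
        let a₁ := pullback.fst f (s' ≫ b)
        have ha₁ : a₁ ≫ f = t ≫ s' ≫ b := pullback.condition
        have hh : a' ≫ f ≫ g = x' ≫ c ≫ f ≫ g := by
          rw [hq.w_assoc, reassoc_of% ha', reassoc_of% hx', h']
        have hh1 : a₁ ≫ f ≫ g = (t ≫ x') ≫ c ≫ f ≫ g := by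
          rw [hq.w_assoc, reassoc_of% ha₁, Category.assoc, reassoc_of% hx', h]
        have hh2 : (t ≫ a') ≫ f ≫ g = (t ≫ x') ≫ c ≫ f ≫ g := by
          rw [Category.assoc, Category.assoc, hh]
        have hst : StrongEpi (t ≫ s') := inferInstance
        have inner : (t ≫ s') ≫ pullback.lift b' w h' ≫ θ = ξ.act (t ≫ a') (t ≫ x') hh2 ≫ q := by
          rw [← Category.assoc, comp_lift']
          exact key _ _ _ _ _ (by simp [ha']) (by simp [hx']) _
        rw [← cancel_epi (t ≫ s')]
        rw [← Category.assoc (t ≫ s'), ← Category.assoc (t ≫ s')]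
        rw [comp_lift', comp_lift']
        rw [key a₁ (ξ.act (t ≫ a') (t ≫ x') hh2) _ _
          (by rw [← Category.assoc (ξ.act _ _ _), ξ.act_c, hh1, hh2]) (by simp [ha₁]) inner,
          ξ.assoc _ _ _ hh1]
        rw [key a₁ (t ≫ x') _ _ hh1 (by simp [ha₁]) (by simp [hx'])] }
  obtain ⟨Z, z, r, hr, hra⟩ := hg y ζ
  refine ⟨Z, z, q ≫ r, ?_, ?_⟩
  · exact hq.paste_vert hr
  · intro S' e x h
    have := hra (e ≫ f) (x ≫ q) (by
      rw [Category.assoc, Category.assoc, ← hq.w_assoc, h])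
    have k := key e x (e ≫ f) (x ≫ q) h rfl rfl (by
      rw [Category.assoc, Category.assoc, ← hq.w_assoc, h])
    change (pullback.lift _ _ _ ≫ θ) ≫ r = _ at this
    rw [k] at this
    simpa using this

end EDComp

section EDCancel

variable [HasZeroObject C] [HasZeroMorphisms C] [HasPullbacks C]

lemma ActEff.cancel (hC : IsHomological C) {A I B : C} {e : A ⟶ I} {m : I ⟶ B}
    [StrongEpi e] (h : ActEff (e ≫ m)) : ActEff m := by
  intro X c ξ
  have hpc : pullback.fst e c ≫ e = pullback.snd e c ≫ c := pullback.condition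
  have cond : ∀ {S : C} (a : S ⟶ A) (w : S ⟶ pullback e c),
      a ≫ e ≫ m = w ≫ pullback.fst e c ≫ e ≫ m →
      (a ≫ e) ≫ m = (w ≫ pullback.snd e c) ≫ c ≫ m := by
    intro S a w hh
    rw [Category.assoc, hh, reassoc_of% hpc, Category.assoc]
  let ξ' : Act (e ≫ m) (pullback.fst e c) :=
    { act := fun a w hh => pullback.lift a (ξ.act (a ≫ e) (w ≫ pullback.snd e c) (cond a w hh))
        (by rw [ξ.act_c])
      nat := fun s a w hh => by
        rw [comp_lift']
        congr 1
        rw [ξ.nat]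
        exact ξ.congr (by simp) (by simp) _
      act_c := fun a w hh => by rw [pullback.lift_fst]
      unit := fun w => by
        apply pullback.hom_ext
        · rw [pullback.lift_fst]
        · rw [pullback.lift_snd]
          refine (ξ.congr (e' := (w ≫ pullback.snd e c) ≫ c) ?_ rfl _).trans (ξ.unit _)
          rw [Category.assoc, hpc, Category.assoc]
      assoc := fun a a' w hh hh' => by
        apply pullback.hom_ext
        · rw [pullback.lift_fst, pullback.lift_fst]
        · refine (pullback.lift_snd _ _ _).trans (Eq.trans ?_ (pullback.lift_snd _ _ _).symm)
          refine (ξ.congr rfl (x' := ξ.act (a' ≫ e) (w ≫ pullback.snd e c) (cond a' w hh')) ?_ _).trans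
            (ξ.assoc _ _ _ (cond a w hh) _)
          rw [pullback.lift_snd] }
  obtain ⟨Z, z, q', hp, hq'⟩ := h _ ξ'
  have hse : StrongEpi (pullback.snd e c) := hC.strongEpi_snd (IsPullback.of_hasPullback e c)
  obtain ⟨q, hq⟩ := hC.desc (pullback.snd e c) q' (by
    intro S a b hab
    have hh : (b ≫ pullback.fst e c) ≫ e ≫ m = a ≫ pullback.fst e c ≫ e ≫ m := by
      rw [reassoc_of% hpc, reassoc_of% hab, Category.assoc, reassoc_of% hpc]
    have h1 := hq' (b ≫ pullback.fst e c) a hh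
    rw [← h1]
    congr 1
    apply pullback.hom_ext
    · rw [ξ'.act_c]
    · change pullback.lift _ _ _ ≫ _ = _
      rw [pullback.lift_snd]
      refine (ξ.congr (e' := (a ≫ pullback.snd e c) ≫ c) ?_ rfl _).trans ((ξ.unit _).trans hab)
      rw [Category.assoc, hpc, hab, Category.assoc])
  have w : c ≫ m = q ≫ z := by
    rw [← cancel_epi (pullback.snd e c), ← reassoc_of% hpc, reassoc_of% hq, hp.w]
  let φ : X ⟶ pullback m z := pullback.lift c q w
  have φ1 : φ ≫ pullback.fst m z = c := pullback.lift_fst _ _ _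
  have φ2 : φ ≫ pullback.snd m z = q := pullback.lift_snd _ _ _
  have hφe : StrongEpi φ := by
    have := hC.strongEpi_snd (IsPullback.of_hasPullback e (pullback.fst m z))
    let s := pullback.snd e (pullback.fst m z)
    let t := pullback.fst e (pullback.fst m z)
    have hst : t ≫ e = s ≫ pullback.fst m z := pullback.condition
    refine hC.strongEpi_of_local φ s
      (hp.lift t (s ≫ pullback.snd m z) (by
        rw [reassoc_of% hst, Category.assoc, pullback.condition]) ≫ pullback.snd e c) ?_
    apply pullback.hom_ext
    · rw [Category.assoc, Category.assoc, φ1, ← hpc, hp.lift_fst_assoc, hst]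
    · rw [Category.assoc, Category.assoc, φ2, hq, hp.lift_snd]
  have hφm : Mono φ := by
    constructor
    intro S a b hab
    have hac : a ≫ c = b ≫ c := by rw [← φ1, reassoc_of% hab]
    have haq : a ≫ q = b ≫ q := by rw [← φ2, reassoc_of% hab]
    have := hC.strongEpi_snd (IsPullback.of_hasPullback e (a ≫ c))
    let s := pullback.snd e (a ≫ c)
    let t := pullback.fst e (a ≫ c)
    have hst : t ≫ e = s ≫ a ≫ c := pullback.condition
    have hst' : t ≫ e = s ≫ b ≫ c := hst.trans (congrArg (s ≫ ·) hac)
    have key : pullback.lift t (s ≫ a) (by rw [hst, Category.assoc]) =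
        pullback.lift t (s ≫ b) (by rw [hst', Category.assoc]) := by
      apply hp.hom_ext
      · rw [pullback.lift_fst, pullback.lift_fst]
      · rw [← hq, pullback.lift_snd_assoc, pullback.lift_snd_assoc, Category.assoc, haq,
          Category.assoc]
    have := congrArg (· ≫ pullback.snd e c) key
    simp only [pullback.lift_snd] at this
    exact (cancel_epi s).1 this
  have hφi : IsIso φ := isIso_of_mono_of_strongEpi φ
  refine ⟨Z, z, q, IsPullback.of_iso_pullback ⟨w⟩ (asIso φ) φ1 φ2, ?_⟩
  intro S i x hh
  have := hC.strongEpi_snd (IsPullback.of_hasPullback e i)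
  have := hC.strongEpi_snd (IsPullback.of_hasPullback e (pullback.snd e i ≫ x ≫ c))
  let s₁ := pullback.snd e (pullback.snd e i ≫ x ≫ c)
  let a' := pullback.fst e (pullback.snd e i ≫ x ≫ c)
  let s := s₁ ≫ pullback.snd e i
  let a := s₁ ≫ pullback.fst e i
  have hs : StrongEpi s := inferInstance
  have ha : a ≫ e = s ≫ i := by
    simp only [a, s, Category.assoc, pullback.condition]
  have ha' : a' ≫ e = (s ≫ x) ≫ c := by
    simp only [a', s, s₁, Category.assoc, pullback.condition]
  have hw : pullback.lift a' (s ≫ x) ha' ≫ pullback.snd e c = s ≫ x := pullback.lift_snd _ _ _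
  have hh' : a ≫ e ≫ m = pullback.lift a' (s ≫ x) ha' ≫ pullback.fst e c ≫ e ≫ m := by
    rw [reassoc_of% hpc, reassoc_of% hw, reassoc_of% ha, hh]
  have h2 := hq' a _ hh'
  have h3 : ξ'.act a _ hh' ≫ pullback.snd e c = s ≫ ξ.act i x hh := by
    change pullback.lift _ _ _ ≫ _ = _
    rw [pullback.lift_snd, ξ.nat]
    exact ξ.congr ha hw _
  rw [← cancel_epi s]
  calc s ≫ ξ.act i x hh ≫ q = (s ≫ ξ.act i x hh) ≫ q := (Category.assoc _ _ _).symm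
    _ = (ξ'.act a _ hh' ≫ pullback.snd e c) ≫ q := by rw [h3]
    _ = ξ'.act a _ hh' ≫ q' := by rw [Category.assoc, hq]
    _ = pullback.lift a' (s ≫ x) ha' ≫ q' := h2
    _ = s ≫ x ≫ q := by rw [← hq, reassoc_of% hw]

end EDCancel

section FromED

variable [HasPullbacks C]

lemma pbmap_left {E B : C} (p : E ⟶ B) {X Y : Over B} (k : X ⟶ Y) :
    ((Over.pullback p).map k).left = pullback.lift (pullback.fst _ _ ≫ k.left) (pullback.snd _ _)
      (by simp [pullback.condition]) := rfl

/-- The map induced on pullbacks along `p`. -/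
noncomputable def pm {X Y E B : C} (φ : X ⟶ Y) (x : X ⟶ B) (y : Y ⟶ B) (p : E ⟶ B) (h : φ ≫ y = x) :
    pullback x p ⟶ pullback y p :=
  pullback.lift (pullback.fst x p ≫ φ) (pullback.snd x p)
    (by rw [Category.assoc, h, pullback.condition])

lemma pm_fst {X Y E B : C} (φ : X ⟶ Y) (x : X ⟶ B) (y : Y ⟶ B) (p : E ⟶ B)
    (h : φ ≫ y = x) : pm φ x y p h ≫ pullback.fst y p = pullback.fst x p ≫ φ :=
  pullback.lift_fst _ _ _

lemma pm_snd {X Y E B : C} (φ : X ⟶ Y) (x : X ⟶ B) (y : Y ⟶ B) (p : E ⟶ B)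
    (h : φ ≫ y = x) : pm φ x y p h ≫ pullback.snd y p = pullback.snd x p :=
  pullback.lift_snd _ _ _

lemma pm_fst_assoc {X Y E B Z : C} (φ : X ⟶ Y) (x : X ⟶ B) (y : Y ⟶ B) (p : E ⟶ B)
    (h : φ ≫ y = x) (t : Y ⟶ Z) :
    pm φ x y p h ≫ pullback.fst y p ≫ t = pullback.fst x p ≫ φ ≫ t := by
  rw [← Category.assoc, pm_fst, Category.assoc]

lemma ed_reflects {E B : C} {p : E ⟶ B} (hp : MonadicRightAdjoint (Over.pullback p)) :
    (Over.pullback p).ReflectsIsomorphisms := by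
  have := hp.eqv
  exact inferInstanceAs ((Monad.comparison hp.adj ⋙ hp.adj.toMonad.forget).ReflectsIsomorphisms)

lemma ed_conservative {E B : C} {p : E ⟶ B} (hp : IsEffectiveDescent p) {X Y : C} (φ : X ⟶ Y)
    (y : Y ⟶ B)
    (inj : ∀ ⦃S : C⦄ (s : S ⟶ E) (a b : S ⟶ X), s ≫ p = a ≫ φ ≫ y → a ≫ φ = b ≫ φ → a = b)
    (surj : ∀ ⦃S : C⦄ (s : S ⟶ E) (t : S ⟶ Y), s ≫ p = t ≫ y → ∃ u : S ⟶ X, u ≫ φ = t) :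
    IsIso φ := by
  obtain ⟨hp⟩ := hp
  have := ed_reflects hp
  let k : Over.mk (φ ≫ y) ⟶ Over.mk y := Over.homMk φ
  obtain ⟨u, hu⟩ := surj (pullback.snd y p) (pullback.fst y p) pullback.condition.symm
  have hu' : u ≫ φ ≫ y = pullback.snd y p ≫ p := by
    rw [reassoc_of% hu, pullback.condition]
  have e1 : pm φ (φ ≫ y) y p rfl ≫ pullback.lift u (pullback.snd y p) hu' =
      𝟙 (pullback (φ ≫ y) p) := by
    apply pullback.hom_ext
    · rw [Category.assoc, pullback.lift_fst, Category.id_comp]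
      apply inj (pullback.snd (φ ≫ y) p)
      · rw [Category.assoc, reassoc_of% hu, pm_fst_assoc, pullback.condition]
      · rw [Category.assoc, hu, pm_fst]
    · rw [Category.assoc, pullback.lift_snd, pm_snd, Category.id_comp]
  have e2 : pullback.lift u (pullback.snd y p) hu' ≫ pm φ (φ ≫ y) y p rfl =
      𝟙 (pullback y p) := by
    apply pullback.hom_ext
    · rw [Category.assoc, pm_fst, pullback.lift_fst_assoc, Category.id_comp, hu]
    · rw [Category.assoc, pm_snd, pullback.lift_snd, Category.id_comp]
  have : IsIso ((Over.pullback p).map k) := by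
    let j : (Over.pullback p).obj (Over.mk y) ⟶ (Over.pullback p).obj (Over.mk (φ ≫ y)) :=
      Over.homMk (pullback.lift u (pullback.snd y p) hu') (pullback.lift_snd _ _ _)
    exact ⟨j, Over.OverMorphism.ext e1, Over.OverMorphism.ext e2⟩
  have hk : IsIso k := isIso_of_reflects_iso k (Over.pullback p)
  exact inferInstanceAs (IsIso ((Over.forget B).map k))

lemma ed_strongEpi [HasZeroObject C] [HasZeroMorphisms C] (hC : IsHomological C) {E B : C}
    {p : E ⟶ B} (hp : IsEffectiveDescent p) : StrongEpi p := by
  obtain ⟨I, e, m, he, hm, fac⟩ := hC.regEpiMonoFac p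
  have := strongEpi_of_re he
  have : IsIso m := ed_conservative hp m (𝟙 B)
    (fun S s a b _ h => (cancel_mono m).1 h)
    (fun S s t h => ⟨s ≫ e, by rw [Category.assoc, fac, h, Category.comp_id]⟩)
  rw [← fac]
  infer_instance

lemma ed_actEff {E B : C} {p : E ⟶ B} (hp : IsEffectiveDescent p) : ActEff p := by
  obtain ⟨hp⟩ := hp
  intro X c ξ
  have hcond : pullback.snd (c ≫ p) p ≫ p = pullback.fst (c ≫ p) p ≫ c ≫ p :=
    pullback.condition.symm
  let α : pullback (c ≫ p) p ⟶ X := ξ.act (pullback.snd (c ≫ p) p) (pullback.fst (c ≫ p) p) hcond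
  have αc : α ≫ c = pullback.snd (c ≫ p) p := ξ.act_c _ _ _
  have lα : ∀ ⦃S : C⦄ (x : S ⟶ X) (e : S ⟶ E) (h : x ≫ c ≫ p = e ≫ p),
      pullback.lift x e h ≫ α = ξ.act e x h.symm := by
    intro S x e h
    rw [ξ.nat]
    exact ξ.congr (pullback.lift_snd _ _ _) (pullback.lift_fst _ _ _) _
  let Xo : Over B := Over.mk (c ≫ p)
  let TX : Over B := Over.mk (pullback.fst (c ≫ p) p ≫ c ≫ p)
  let u : TX ⟶ Xo := Over.homMk (pullback.fst (c ≫ p) p) rfl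
  let v : TX ⟶ Xo := Over.homMk α (by
    change α ≫ c ≫ p = pullback.fst (c ≫ p) p ≫ c ≫ p
    rw [reassoc_of% αc, hcond])
  let G := Over.pullback p
  let π : G.obj Xo ⟶ Over.mk c := Over.homMk α αc
  let r : Over.mk c ⟶ G.obj Xo :=
    Over.homMk (pullback.lift (𝟙 X) c (Category.id_comp _)) (pullback.lift_snd _ _ _)
  let L : pullback (c ≫ p) p ⟶ pullback (pullback.fst (c ≫ p) p ≫ c ≫ p) p :=
    pullback.lift (𝟙 (pullback (c ≫ p) p)) (pullback.snd (c ≫ p) p)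
      (by rw [Category.id_comp, hcond])
  have L1 : L ≫ pullback.fst _ _ = 𝟙 _ := pullback.lift_fst _ _ _
  have L2 : L ≫ pullback.snd _ _ = pullback.snd _ _ := pullback.lift_snd _ _ _
  let l : G.obj Xo ⟶ G.obj TX := Over.homMk L L2
  have hα : α ≫ c ≫ p = pullback.fst (c ≫ p) p ≫ c ≫ p := by
    rw [reassoc_of% αc, hcond]
  have e1 : pm α _ _ p hα ≫ α = pm (pullback.fst (c ≫ p) p) _ _ p rfl ≫ α := by
    unfold pm
    rw [lα, lα]
    refine (ξ.congr rfl (ξ.nat _ _ _ _) _).trans (ξ.assoc _ _ _ _ _)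
  have e2 : pullback.lift (𝟙 X) c (Category.id_comp _) ≫ α = 𝟙 X := by
    rw [lα]
    exact (ξ.congr (Category.id_comp _).symm rfl _).trans (ξ.unit (𝟙 X))
  have e3 : L ≫ pm (pullback.fst (c ≫ p) p) _ (c ≫ p) p rfl = 𝟙 _ := by
    apply pullback.hom_ext
    · rw [Category.assoc, pm_fst, reassoc_of% L1, Category.id_comp]
    · rw [Category.assoc, pm_snd, L2, Category.id_comp]
  have e4 : L ≫ pm α _ (c ≫ p) p hα = α ≫ pullback.lift (𝟙 X) c (Category.id_comp _) := by
    apply pullback.hom_ext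
    · rw [Category.assoc, pm_fst, reassoc_of% L1, Category.assoc, pullback.lift_fst,
        Category.comp_id]
    · rw [Category.assoc, pm_snd, L2, Category.assoc, pullback.lift_snd, αc]
  let sc : IsSplitCoequalizer (G.map v) (G.map u) π :=
    { rightSection := r
      leftSection := l
      condition := Over.OverMorphism.ext e1
      rightSection_π := Over.OverMorphism.ext e2
      leftSection_bottom := Over.OverMorphism.ext e3
      leftSection_top := Over.OverMorphism.ext e4 }
  have : G.IsSplitPair v u := ⟨_, π, ⟨sc⟩⟩
  letI cr : CreatesColimit (parallelPair v u) G := Monad.createsGSplitCoequalizersOfMonadic G v u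
  haveI : HasColimit (parallelPair v u ⋙ G) :=
    haveI : HasColimit (parallelPair ((parallelPair v u ⋙ G).map WalkingParallelPairHom.left)
        ((parallelPair v u ⋙ G).map WalkingParallelPairHom.right)) := ⟨⟨_, sc.isCoequalizer⟩⟩
    hasColimit_of_iso (diagramIsoParallelPair _)
  haveI : HasColimit (parallelPair v u) := hasColimit_of_created _ G
  haveI : PreservesColimit (parallelPair v u) G :=
    preservesColimit_of_createsColimit_and_hasColimit _ G
  let Z := coequalizer v u
  let Q : Xo ⟶ Z := coequalizer.π v u
  have hQ : v ≫ Q = u ≫ Q := coequalizer.condition v u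
  have hcol := isColimitOfHasCoequalizerOfPreservesColimit G v u
  let φ : Over.mk c ≅ G.obj Z := sc.isCoequalizer.coconePointUniqueUpToIso hcol
  have hφ : π ≫ φ.hom = G.map Q :=
    sc.isCoequalizer.comp_coconePointUniqueUpToIso_hom hcol WalkingParallelPair.one
  have hφ' : φ.hom = r ≫ G.map Q := by
    rw [← hφ, ← Category.assoc, sc.rightSection_π, Category.id_comp]
  have hvu : α ≫ Q.left = pullback.fst (c ≫ p) p ≫ Q.left := congrArg CommaMorphism.left hQ
  have w : Q.left ≫ Z.hom = c ≫ p := Over.w Q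
  have hφl : φ.hom.left = pullback.lift (𝟙 X) c (Category.id_comp _) ≫ pm Q.left _ Z.hom p w := by
    rw [hφ']; rfl
  have hi : IsIso φ.hom.left := inferInstanceAs (IsIso ((Over.forget E).map φ.hom))
  refine ⟨Z.left, Z.hom, Q.left, ?_, ?_⟩
  · refine (IsPullback.of_iso_pullback ⟨w⟩ (asIso φ.hom.left) ?_ ?_).flip
    · change φ.hom.left ≫ _ = _
      rw [hφl, Category.assoc, pm_fst, pullback.lift_fst_assoc]
      exact Category.id_comp _
    · change φ.hom.left ≫ _ = _
      rw [hφl, Category.assoc, pm_snd, pullback.lift_snd]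
  · intro S e x h
    rw [← lα x e h.symm, Category.assoc, hvu, pullback.lift_fst_assoc]

end FromED

section ToED

variable [HasPullbacks C]

lemma mpa_counit_left {E B : C} (p : E ⟶ B) (Z : Over B) :
    ((Over.mapPullbackAdj p).counit.app Z).left = pullback.fst Z.hom p := by
  simp

lemma mpa_unit_left {E B : C} (p : E ⟶ B) (A : Over E) :
    ((Over.mapPullbackAdj p).unit.app A).left =
      pullback.lift (f := A.hom ≫ p) (g := p) (𝟙 A.left) A.hom (by rw [Category.id_comp]) := by
  simp

lemma over_eq {B : C} {X Y : Over B} {f g : X ⟶ Y} (h : f = g) : f.left = g.left := by rw [h]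

lemma pm_congr {X Y E B : C} {φ φ' : X ⟶ Y} (x : X ⟶ B) (y : Y ⟶ B) (p : E ⟶ B) (h : φ ≫ y = x)
    (hφ : φ = φ') : pm φ x y p h = pm φ' x y p (by rw [← hφ, h]) := by
  subst hφ; rfl

lemma cmp_a_left {E B : C} (p : E ⟶ B) (Z : Over B) :
    ((Monad.comparison (Over.mapPullbackAdj p)).obj Z).a.left =
      pm (pullback.fst Z.hom p) (pullback.snd Z.hom p ≫ p) Z.hom p pullback.condition :=
  pm_congr _ _ _ (Over.w ((Over.mapPullbackAdj p).counit.app Z)) (mpa_counit_left p Z)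

lemma lift_pm {X Y E B S : C} (φ : X ⟶ Y) (x : X ⟶ B) (y : Y ⟶ B) (p : E ⟶ B) (h : φ ≫ y = x)
    (a : S ⟶ X) (b : S ⟶ E) (w : a ≫ x = b ≫ p) :
    pullback.lift a b w ≫ pm φ x y p h = pullback.lift (a ≫ φ) b (by rw [Category.assoc, h, w]) := by
  apply pullback.hom_ext
  · rw [Category.assoc, pm_fst, pullback.lift_fst, pullback.lift_fst_assoc]
  · rw [Category.assoc, pm_snd, pullback.lift_snd, pullback.lift_snd]

lemma comp_lift0 {S S' X Y Z : C} (s : S' ⟶ S) {f : X ⟶ Z} {g : Y ⟶ Z} (a : S ⟶ X) (b : S ⟶ Y)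
    (h : a ≫ f = b ≫ g) :
    s ≫ pullback.lift a b h = pullback.lift (s ≫ a) (s ≫ b) (by simp [h]) := by
  apply pullback.hom_ext
  · rw [Category.assoc, pullback.lift_fst, pullback.lift_fst]
  · rw [Category.assoc, pullback.lift_snd, pullback.lift_snd]

lemma lift_congr {S X Y Z : C} {f : X ⟶ Z} {g : Y ⟶ Z} {a a' : S ⟶ X} {b b' : S ⟶ Y}
    (h : a ≫ f = b ≫ g) (ha : a = a') (hb : b = b') :
    pullback.lift a b h = pullback.lift a' b' (by rw [← ha, ← hb, h]) := by
  subst ha hb; rfl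

lemma alg_act {E B : C} (p : E ⟶ B) (A : (Over.mapPullbackAdj p).toMonad.Algebra) :
    ∃ ξ : Act p A.A.hom, ∀ ⦃S : C⦄ (e : S ⟶ E) (x : S ⟶ A.A.left) (h : e ≫ p = x ≫ A.A.hom ≫ p),
      ξ.act e x h = pullback.lift x e h.symm ≫ A.a.left := by
  obtain ⟨A, a, un, as⟩ := A
  let c : A.left ⟶ E := A.hom
  let α : pullback (c ≫ p) p ⟶ A.left := a.left
  have αc : α ≫ c = pullback.snd (c ≫ p) p := Over.w a
  have hcond : pullback.fst (c ≫ p) p ≫ c ≫ p = pullback.snd (c ≫ p) p ≫ p :=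
    pullback.condition
  have hα : α ≫ c ≫ p = pullback.snd (c ≫ p) p ≫ p := by rw [reassoc_of% αc]
  have e1 : pullback.lift (𝟙 A.left) c (by rw [Category.id_comp]) ≫ α = 𝟙 A.left := by
    have h := over_eq un
    refine Eq.trans ?_ h
    refine Eq.trans ?_ (congrArg (· ≫ α) (mpa_unit_left p A).symm)
    rfl
  have e2 : pm (pullback.fst (c ≫ p) p) (pullback.snd (c ≫ p) p ≫ p) (c ≫ p) p hcond ≫ α =
      pm α (pullback.snd (c ≫ p) p ≫ p) (c ≫ p) p hα ≫ α := by
    have h := over_eq as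
    refine Eq.trans ?_ h
    refine congrArg (· ≫ α) (pm_congr _ _ _ _ ?_)
    exact (mpa_counit_left p ((Over.map p).obj A)).symm
  refine ⟨{ act := fun e x h => pullback.lift x e h.symm ≫ α
            nat := ?_, act_c := ?_, unit := ?_, assoc := ?_ }, fun S e x h => rfl⟩
  · intro S S' s e x h
    rw [← Category.assoc, comp_lift0]
  · intro S e x h
    exact (Category.assoc _ _ _).trans ((congrArg _ αc).trans (pullback.lift_snd _ _ _))
  · intro S x
    have : pullback.lift x (x ≫ c) (by rw [Category.assoc]) =
        x ≫ pullback.lift (f := c ≫ p) (g := p) (𝟙 A.left) c (by rw [Category.id_comp]) := by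
      rw [comp_lift0]
      exact lift_congr _ (Category.comp_id x).symm rfl
    refine (congrArg (· ≫ α) this).trans ?_
    change (_ ≫ _) ≫ _ = _
    rw [Category.assoc, e1, Category.comp_id]
  · intro S e e' x h h'
    have h1 : x ≫ c ≫ p = e' ≫ p := h'.symm
    have h2 : pullback.lift x e' h1 ≫ pullback.snd (c ≫ p) p ≫ p = e ≫ p := by
      rw [pullback.lift_snd_assoc]; exact h'.trans h.symm
    have h3 := congrArg (pullback.lift (pullback.lift x e' h1) e h2 ≫ ·) e2
    simp only [← Category.assoc, lift_pm] at h3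
    refine h3.symm.trans ?_
    exact congrArg (· ≫ α) (lift_congr _ (pullback.lift_fst _ _ _) rfl)

lemma ed_of_actEff [HasZeroObject C] [HasZeroMorphisms C] (hC : IsHomological C) {E B : C}
    {p : E ⟶ B} [StrongEpi p] (hp : ActEff p) : IsEffectiveDescent p := by
  have se : ∀ {Z : C} (z : Z ⟶ B), StrongEpi (pullback.fst z p) := fun z =>
    hC.strongEpi_fst (IsPullback.of_hasPullback z p)
  let K := Monad.comparison (Over.mapPullbackAdj p)
  have faith : K.Faithful := by
    constructor
    intro D D' k k' hk
    have h1 : pm k.left D.hom D'.hom p (Over.w k) = pm k'.left D.hom D'.hom p (Over.w k') :=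
      over_eq (congrArg Monad.Algebra.Hom.f hk)
    apply Over.OverMorphism.ext
    have := se D.hom
    rw [← cancel_epi (pullback.fst D.hom p), ← pm_fst _ _ _ _ (Over.w k),
      ← pm_fst _ _ _ _ (Over.w k'), h1]
  have full : K.Full := by
    constructor
    intro D D' k
    let θ : pullback D.hom p ⟶ pullback D'.hom p := k.f.left
    have θs : θ ≫ pullback.snd D'.hom p = pullback.snd D.hom p := Over.w k.f
    have θh : pm θ (pullback.snd D.hom p ≫ p) (pullback.snd D'.hom p ≫ p) p
          (by rw [reassoc_of% θs]) ≫
        pm (pullback.fst D'.hom p) (pullback.snd D'.hom p ≫ p) D'.hom p pullback.condition =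
        pm (pullback.fst D.hom p) (pullback.snd D.hom p ≫ p) D.hom p pullback.condition ≫ θ := by
      have h := over_eq k.h
      refine Eq.trans ?_ (h.trans ?_)
      · exact congrArg (pm θ _ _ p _ ≫ ·) (cmp_a_left p D').symm
      · exact congrArg (· ≫ θ) (cmp_a_left p D)
    have := se D.hom
    obtain ⟨l, hl⟩ := hC.desc (pullback.fst D.hom p) (θ ≫ pullback.fst D'.hom p) (by
      intro S a b hab
      have hb : b ≫ pullback.snd D.hom p ≫ p = (a ≫ pullback.snd D.hom p) ≫ p := by
        rw [← pullback.condition, ← reassoc_of% hab, pullback.condition, Category.assoc]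
      have h := congrArg (pullback.lift b (a ≫ pullback.snd D.hom p) hb ≫ ·) θh
      simp only [← Category.assoc, lift_pm] at h
      have h2 : pullback.lift (b ≫ pullback.fst D.hom p) (a ≫ pullback.snd D.hom p)
          (by rw [Category.assoc, pullback.condition, hb]) = a := by
        apply pullback.hom_ext
        · rw [pullback.lift_fst, hab]
        · rw [pullback.lift_snd]
      rw [h2] at h
      have h3 := congrArg (· ≫ pullback.fst D'.hom p) h
      simp only [pullback.lift_fst, Category.assoc] at h3
      exact h3.symm)
    have hw : l ≫ D'.hom = D.hom := by
      rw [← cancel_epi (pullback.fst D.hom p), reassoc_of% hl, pullback.condition,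
        reassoc_of% θs, pullback.condition]
    refine ⟨Over.homMk l hw, ?_⟩
    apply Monad.Algebra.Hom.ext
    apply Over.OverMorphism.ext
    change pm l D.hom D'.hom p hw = θ
    apply pullback.hom_ext
    · rw [pm_fst, hl]
    · rw [pm_snd, θs]
  have ess : K.EssSurj := by
    constructor
    intro A
    obtain ⟨ξ, hξ⟩ := alg_act p A
    obtain ⟨Z, z, q, hpb, hq⟩ := hp _ ξ
    let ψ : A.A.left ≅ pullback z p := hpb.flip.isoPullback
    have ψ1 : ψ.hom ≫ pullback.fst z p = q := hpb.flip.isoPullback_hom_fst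
    have ψ2 : ψ.hom ≫ pullback.snd z p = A.A.hom := hpb.flip.isoPullback_hom_snd
    let i : A.A ≅ (Over.pullback p).obj (Over.mk z) := Over.isoMk ψ ψ2
    refine ⟨Over.mk z, ⟨(Monad.Algebra.isoMk (B := K.obj (Over.mk z)) i ?_).symm⟩⟩
    apply Over.OverMorphism.ext
    let α : pullback (A.A.hom ≫ p) p ⟶ A.A.left := A.a.left
    have αc : α ≫ A.A.hom = pullback.snd (A.A.hom ≫ p) p := Over.w A.a
    have key : pm ψ.hom (A.A.hom ≫ p) (pullback.snd z p ≫ p) p (by rw [reassoc_of% ψ2]) ≫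
        pm (pullback.fst z p) (pullback.snd z p ≫ p) z p pullback.condition = α ≫ ψ.hom := by
      apply pullback.hom_ext
      · rw [Category.assoc, Category.assoc, pm_fst, pm_fst_assoc, ψ1]
        have h1 : pullback.snd (A.A.hom ≫ p) p ≫ p =
          pullback.fst (A.A.hom ≫ p) p ≫ A.A.hom ≫ p := pullback.condition.symm
        have h2 := hq _ _ h1
        rw [hξ] at h2
        rw [← h2]
        refine congrArg (· ≫ q) ?_
        refine Eq.trans ?_ (Category.id_comp α)
        refine congrArg (· ≫ α) ?_
        apply pullback.hom_ext
        · exact (pullback.lift_fst _ _ _).trans (Category.id_comp _).symm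
        · exact (pullback.lift_snd _ _ _).trans (Category.id_comp _).symm
      · rw [Category.assoc, Category.assoc, pm_snd, pm_snd, ψ2, αc]
    refine Eq.trans ?_ key
    exact congrArg (pm ψ.hom _ _ p _ ≫ ·) (cmp_a_left p (Over.mk z))
  exact ⟨{ L := Over.map p
           adj := Over.mapPullbackAdj p
           eqv := { } }⟩

lemma ed_comp [HasZeroObject C] [HasZeroMorphisms C] (hC : IsHomological C) {A B D : C}
    {f : A ⟶ B} {g : B ⟶ D} (hf : IsEffectiveDescent f) (hg : IsEffectiveDescent g) :
    IsEffectiveDescent (f ≫ g) := by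
  have := ed_strongEpi hC hf
  have := ed_strongEpi hC hg
  have := strongEpi_comp f g
  exact ed_of_actEff hC (ActEff.comp hC (ed_actEff hf) (ed_actEff hg))

lemma ed_cancel [HasZeroObject C] [HasZeroMorphisms C] (hC : IsHomological C) {A B D : C}
    {f : A ⟶ B} [StrongEpi f] {g : B ⟶ D} (hf : IsEffectiveDescent (f ≫ g)) :
    IsEffectiveDescent g := by
  have := ed_strongEpi hC hf
  have := strongEpi_of_strongEpi f g
  exact ed_of_actEff hC (ActEff.cancel hC (ed_actEff hf))

end ToED

section Kernels

variable [HasZeroMorphisms C]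

lemma IsKernelOf.w {K A B : C} {k : K ⟶ A} {f : A ⟶ B} (h : IsKernelOf k f) : k ≫ f = 0 := h.1

lemma IsKernelOf.lift {K A B S : C} {k : K ⟶ A} {f : A ⟶ B} (h : IsKernelOf k f) (x : S ⟶ A)
    (hx : x ≫ f = 0) : ∃ l : S ⟶ K, l ≫ k = x := by
  obtain ⟨w, ⟨hl⟩⟩ := h
  obtain ⟨l, hl⟩ := KernelFork.IsLimit.lift' hl x hx
  exact ⟨l, hl⟩

lemma IsKernelOf.mono {K A B : C} {k : K ⟶ A} {f : A ⟶ B} (h : IsKernelOf k f) : Mono k := by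
  obtain ⟨w, ⟨hl⟩⟩ := h
  exact ⟨fun a b hab => Fork.IsLimit.hom_ext hl hab⟩

lemma isKernelOf_mk {K A B : C} (k : K ⟶ A) (f : A ⟶ B) (w : k ≫ f = 0) [Mono k]
    (h : ∀ ⦃S : C⦄ (x : S ⟶ A), x ≫ f = 0 → ∃ l : S ⟶ K, l ≫ k = x) : IsKernelOf k f := by
  refine ⟨w, ⟨KernelFork.IsLimit.ofι k w (fun x hx => (h x hx).choose)
    (fun x hx => (h x hx).choose_spec) (fun x hx m hm => ?_)⟩⟩
  rw [← cancel_mono k, hm, (h x hx).choose_spec]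

lemma IsCokernelOf.desc {K A B S : C} {k : K ⟶ A} {f : A ⟶ B} (h : IsCokernelOf f k) (x : A ⟶ S)
    (hx : k ≫ x = 0) : ∃ l : B ⟶ S, f ≫ l = x := by
  obtain ⟨w, ⟨hl⟩⟩ := h
  obtain ⟨l, hl⟩ := CokernelCofork.IsColimit.desc' hl x hx
  exact ⟨l, hl⟩

lemma IsCokernelOf.epi {K A B : C} {k : K ⟶ A} {f : A ⟶ B} (h : IsCokernelOf f k) : Epi f := by
  obtain ⟨w, ⟨hl⟩⟩ := h
  exact ⟨fun a b hab => Cofork.IsColimit.hom_ext hl hab⟩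

lemma isCokernelOf_mk {K A B : C} (k : K ⟶ A) (f : A ⟶ B) (w : k ≫ f = 0) [Epi f]
    (h : ∀ ⦃S : C⦄ (x : A ⟶ S), k ≫ x = 0 → ∃ l : B ⟶ S, f ≫ l = x) : IsCokernelOf f k := by
  refine ⟨w, ⟨CokernelCofork.IsColimit.ofπ f w (fun x hx => (h x hx).choose)
    (fun x hx => (h x hx).choose_spec) (fun x hx m hm => ?_)⟩⟩
  rw [← cancel_epi f, hm, (h x hx).choose_spec]

lemma exists_kernel [HasZeroObject C] (hC : IsHomological C) {A B : C} (f : A ⟶ B) :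
    ∃ (K : C) (k : K ⟶ A), IsKernelOf k f := by
  have := hC.hasFiniteLimits
  exact ⟨kernel f, kernel.ι f, isKernelOf_mk _ _ (kernel.condition f)
    (fun S x hx => ⟨kernel.lift f x hx, kernel.lift_ι _ _ _⟩)⟩

/-- Kernels of pullbacks. -/
lemma ker_fst {P X Y Z K : C} {fst : P ⟶ X} {snd : P ⟶ Y} {f : X ⟶ Z} {g : Y ⟶ Z}
    (h : IsPullback fst snd f g) {k : K ⟶ Y} (hk : IsKernelOf k g) {k' : K ⟶ P}
    (h1 : k' ≫ fst = 0) (h2 : k' ≫ snd = k) : IsKernelOf k' fst := by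
  have := hk.mono
  have : Mono (k' ≫ snd) := by rw [h2]; infer_instance
  have : Mono k' := mono_of_mono k' snd
  refine isKernelOf_mk _ _ h1 (fun S x hx => ?_)
  obtain ⟨l, hl⟩ := hk.lift (x ≫ snd) (by rw [Category.assoc, ← h.w, reassoc_of% hx, zero_comp])
  refine ⟨l, h.hom_ext ?_ ?_⟩
  · rw [Category.assoc, h1, comp_zero, hx]
  · rw [Category.assoc, h2, hl]

lemma isPullback_of_mono {P X Y Z : C} {fst : P ⟶ X} {snd : P ⟶ Y} {f : X ⟶ Z} {g : Y ⟶ Z}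
    (w : fst ≫ f = snd ≫ g) [Mono snd]
    (h : ∀ ⦃S : C⦄ (a : S ⟶ X) (b : S ⟶ Y), a ≫ f = b ≫ g →
      ∃ l : S ⟶ P, l ≫ fst = a ∧ l ≫ snd = b) : IsPullback fst snd f g :=
  ⟨⟨w⟩, ⟨PullbackCone.IsLimit.mk w (fun s => (h s.fst s.snd s.condition).choose)
    (fun s => (h s.fst s.snd s.condition).choose_spec.1)
    (fun s => (h s.fst s.snd s.condition).choose_spec.2)
    (fun s m _ h2 => by
      rw [← cancel_mono snd, h2, (h s.fst s.snd s.condition).choose_spec.2])⟩⟩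

lemma ker_pb {A I B K K' : C} {e : A ⟶ I} {m : I ⟶ B} {k : K ⟶ A} {k' : K' ⟶ I} {r : K ⟶ K'}
    (hk : IsKernelOf k (e ≫ m)) (hk' : IsKernelOf k' m) (hr : r ≫ k' = k ≫ e) :
    IsPullback r k k' e := by
  have := hk.mono
  have := hk'.mono
  refine isPullback_of_mono hr (fun S a b hab => ?_)
  obtain ⟨l, hl⟩ := hk.lift b (by rw [← reassoc_of% hab, hk'.w, comp_zero])
  exact ⟨l, by rw [← cancel_mono k', Category.assoc, hr, reassoc_of% hl, hab], hl⟩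

lemma ker_map {A I B K K' : C} {e : A ⟶ I} {m : I ⟶ B} {f : A ⟶ B} {k : K ⟶ A} {k' : K' ⟶ I}
    (hk : IsKernelOf k f) (hk' : IsKernelOf k' m) (h : e ≫ m = f) :
    ∃ r : K ⟶ K', r ≫ k' = k ≫ e :=
  hk'.lift _ (by rw [Category.assoc, h, hk.w])

lemma coker_of_kernel [HasZeroObject C] [HasPullbacks C] (hC : IsHomological C) {K A B : C}
    {k : K ⟶ A} {f : A ⟶ B} [StrongEpi f] (hk : IsKernelOf k f) : IsCokernelOf f k := by
  have := hC.hasFiniteLimits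
  refine isCokernelOf_mk _ _ hk.w (fun S h hh => ?_)
  have hpb := IsPullback.of_hasPullback f f
  let p1 := pullback.fst f f
  let p2 := pullback.snd f f
  let ι := equalizer.ι (p1 ≫ h) (p2 ≫ h)
  let d : A ⟶ pullback f f := pullback.lift (𝟙 A) (𝟙 A) rfl
  have d1 : d ≫ p1 = 𝟙 A := pullback.lift_fst _ _ _
  have d2 : d ≫ p2 = 𝟙 A := pullback.lift_snd _ _ _
  let u : K ⟶ pullback f f := pullback.lift 0 k (by rw [zero_comp, hk.w])
  have u1 : u ≫ p1 = 0 := pullback.lift_fst _ _ _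
  have u2 : u ≫ p2 = k := pullback.lift_snd _ _ _
  let d' : A ⟶ equalizer (p1 ≫ h) (p2 ≫ h) := equalizer.lift d (by
    rw [reassoc_of% d1, reassoc_of% d2])
  let u' : K ⟶ equalizer (p1 ≫ h) (p2 ≫ h) := equalizer.lift u (by
    rw [reassoc_of% u1, reassoc_of% u2, zero_comp, hh])
  have hd' : d' ≫ ι = d := equalizer.lift_ι _ _
  have hu' : u' ≫ ι = u := equalizer.lift_ι _ _
  have hu : IsKernelOf u p1 := ker_fst hpb hk u1 u2
  have := hu.mono
  have : Mono (u' ≫ ι) := by rw [hu']; infer_instance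
  have : Mono u' := mono_of_mono u' ι
  have hk' : IsKernelOf u' (ι ≫ p1) := by
    refine isKernelOf_mk _ _ (by rw [reassoc_of% hu', u1]) (fun T x hx => ?_)
    obtain ⟨l, hl⟩ := hu.lift (x ≫ ι) (by rw [Category.assoc, hx])
    exact ⟨l, by rw [← cancel_mono ι, Category.assoc, hu', hl]⟩
  have : IsIso ι := hC.protomodular u' (ι ≫ p1) d' u p1 d (𝟙 K) ι (𝟙 A)
    ⟨hk', by rw [reassoc_of% hd', d1]⟩ ⟨hu, d1⟩ (by rw [hu', Category.id_comp])
    (by rw [Category.comp_id]) (by rw [hd', Category.id_comp]) inferInstance inferInstance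
  have key : p1 ≫ h = p2 ≫ h := by
    rw [← cancel_epi ι]; exact equalizer.condition _ _
  refine hC.desc f h (fun T a b hab => ?_)
  have := congrArg (pullback.lift a b hab ≫ ·) key
  simpa [p1, p2, pullback.lift_fst_assoc, pullback.lift_snd_assoc] using this

end Kernels

section Torsion

variable [HasZeroObject C] [HasZeroMorphisms C] [HasPullbacks C] {Tp Fp : C → Prop}

lemma fp_of_zero (tt : TorsionTheory C Tp Fp) (R : Reflection C Fp)
    (hR : ∀ X : C, ∃ (K : C) (k : K ⟶ X), Tp K ∧ IsShortExact k (R.η.app X)) {X : C}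
    (h : ∀ ⦃T : C⦄ (t : T ⟶ X), Tp T → t = 0) : Fp X := by
  obtain ⟨K, k, hK, hs⟩ := hR X
  have := hs.isCokernel.epi
  obtain ⟨l, hl⟩ := hs.isCokernel.desc (𝟙 X) (by rw [h k hK, zero_comp])
  have : IsIso (R.η.app X) := ⟨l, hl, by
    rw [← cancel_epi (R.η.app X), reassoc_of% hl, Category.comp_id]⟩
  exact tt.repleteF (R.mem X) (asIso (R.η.app X)).symm

lemma eta_iso (R : Reflection C Fp) {X : C} (hX : Fp X) : IsIso (R.η.app X) := by
  obtain ⟨g, hg, -⟩ := R.univ hX (𝟙 X)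
  refine ⟨g, hg, ?_⟩
  refine (R.univ (R.mem X) (R.η.app X)).unique ?_ ?_
  · rw [← Category.assoc]
    exact (congrArg (· ≫ R.η.app X) hg).trans (Category.id_comp _)
  · exact Category.comp_id _

lemma eta_nat (R : Reflection C Fp) {X Y : C} (f : X ⟶ Y) :
    f ≫ R.η.app Y = R.η.app X ≫ R.F.map f := R.η.naturality f

lemma eta_hom_ext (R : Reflection C Fp) {X Y : C} (hY : Fp Y) {a b : R.F.obj X ⟶ Y}
    (h : R.η.app X ≫ a = R.η.app X ≫ b) : a = b :=
  (R.univ hY _).unique h rfl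

lemma inverted_of_torsion (hC : IsHomological C) (tt : TorsionTheory C Tp Fp) (R : Reflection C Fp)
    {T X Y : C} {e : X ⟶ Y} [StrongEpi e] {k : T ⟶ X} (hk : IsKernelOf k e) (hT : Tp T) :
    IsIso (R.F.map e) := by
  obtain ⟨l, hl⟩ := (coker_of_kernel hC hk).desc (R.η.app X) (tt.hom_zero _ hT (R.mem X))
  obtain ⟨g, hg, -⟩ := R.univ (R.mem X) l
  refine ⟨g, eta_hom_ext R (R.mem _) ?_, eta_hom_ext R (R.mem _) ?_⟩
  · rw [← Category.assoc, ← eta_nat, Category.assoc, hg]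
    exact hl.trans (Category.comp_id _).symm
  · rw [← Category.assoc, hg, ← cancel_epi e]
    refine (Category.assoc _ _ _).symm.trans ((congrArg (· ≫ R.F.map e) hl).trans ?_)
    refine (eta_nat R e).symm.trans ?_
    exact congrArg (e ≫ ·) (Category.comp_id _).symm

lemma stably_of_torsion (hC : IsHomological C) (tt : TorsionTheory C Tp Fp) (R : Reflection C Fp)
    {T X Y : C} {e : X ⟶ Y} [StrongEpi e] {k : T ⟶ X} (hk : IsKernelOf k e) (hT : Tp T) :
    StablyIn (invertedByR R) e := by
  intro Pb W fst snd g h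
  have := hC.strongEpi_fst h
  exact inverted_of_torsion hC tt R (k := h.lift 0 k (by rw [zero_comp, hk.w]))
    (ker_fst h hk (h.lift_fst _ _ _) (h.lift_snd _ _ _)) hT

lemma ne_ker (tt : TorsionTheory C Tp Fp) (R : Reflection C Fp)
    (hR : ∀ X : C, ∃ (K : C) (k : K ⟶ X), Tp K ∧ IsShortExact k (R.η.app X))
    {A B K : C} {m : A ⟶ B} {k : K ⟶ A} (hm : IsNormalExt R m) (hk : IsKernelOf k m) : Fp K := by
  obtain ⟨-, Pb, p1, p2, hpb, htr⟩ := hm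
  have := hk.mono
  refine fp_of_zero tt R hR (fun T t hT => ?_)
  let u : K ⟶ Pb := hpb.lift 0 k (by rw [zero_comp, hk.w])
  have u1 : u ≫ p1 = 0 := hpb.lift_fst _ _ _
  have u2 : u ≫ p2 = k := hpb.lift_snd _ _ _
  have h0 : t ≫ u = 0 := by
    apply htr.hom_ext
    · rw [zero_comp]; exact tt.hom_zero _ hT (R.mem _)
    · rw [Category.assoc, u1, comp_zero, zero_comp]
  rw [← cancel_mono k, ← u2, reassoc_of% h0, zero_comp, zero_comp]

lemma ne_of_ker (hC : IsHomological C) (R : Reflection C Fp) (hP : IsProtoadditive R.F)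
    {A B K : C} {m : A ⟶ B} {k : K ⟶ A} (hm : IsEffectiveDescent m) (hk : IsKernelOf k m)
    (hK : Fp K) : IsNormalExt R m := by
  refine ⟨hm, pullback m m, pullback.fst m m, pullback.snd m m, IsPullback.of_hasPullback m m, ?_⟩
  have hpb := IsPullback.of_hasPullback m m
  let p1 := pullback.fst m m
  let u : K ⟶ pullback m m := hpb.lift 0 k (by rw [zero_comp, hk.w])
  have u1 : u ≫ p1 = 0 := hpb.lift_fst _ _ _
  have u2 : u ≫ pullback.snd m m = k := hpb.lift_snd _ _ _
  let d : A ⟶ pullback m m := hpb.lift (𝟙 A) (𝟙 A) rfl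
  have d1 : d ≫ p1 = 𝟙 A := hpb.lift_fst _ _ _
  have hs : IsSplitShortExact u p1 d := ⟨ker_fst hpb hk u1 u2, d1⟩
  have hFs := hP _ _ _ hs
  let η0 : pullback m m ⟶ R.F.obj (pullback m m) := R.η.app _
  let ηA : A ⟶ R.F.obj A := R.η.app _
  let ηK : K ⟶ R.F.obj K := R.η.app _
  have n1 : p1 ≫ ηA = η0 ≫ R.F.map p1 := eta_nat R p1
  have n2 : d ≫ η0 = ηA ≫ R.F.map d := eta_nat R d
  have n3 : u ≫ η0 = ηK ≫ R.F.map u := eta_nat R u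
  have hQ := (IsPullback.of_hasPullback (R.F.map p1) ηA).flip
  let φ : pullback m m ⟶ pullback (R.F.map p1) ηA := hQ.lift p1 η0 n1
  have φ1 : φ ≫ pullback.snd _ _ = p1 := hQ.lift_fst _ _ _
  have φ2 : φ ≫ pullback.fst _ _ = η0 := hQ.lift_snd _ _ _
  let kQ : R.F.obj K ⟶ pullback (R.F.map p1) ηA := hQ.lift 0 (R.F.map u) (by
    rw [zero_comp, hFs.isKernel.w])
  have kQ1 : kQ ≫ pullback.snd _ _ = 0 := hQ.lift_fst _ _ _
  have kQ2 : kQ ≫ pullback.fst _ _ = R.F.map u := hQ.lift_snd _ _ _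
  let sQ : A ⟶ pullback (R.F.map p1) ηA := hQ.lift (𝟙 A) (ηA ≫ R.F.map d) (by
    rw [Category.assoc, hFs.split, Category.comp_id, Category.id_comp])
  have sQ1 : sQ ≫ pullback.snd _ _ = 𝟙 A := hQ.lift_fst _ _ _
  have sQ2 : sQ ≫ pullback.fst _ _ = ηA ≫ R.F.map d := hQ.lift_snd _ _ _
  have hηK : IsIso ηK := eta_iso R hK
  have hi : IsIso φ := hC.protomodular u p1 d kQ (pullback.snd _ _) sQ ηK φ (𝟙 A) hs
    ⟨ker_fst hQ hFs.isKernel kQ1 kQ2, sQ1⟩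
    (hQ.hom_ext (by rw [Category.assoc, Category.assoc, φ1, kQ1, u1, comp_zero])
      (by rw [Category.assoc, Category.assoc, φ2, kQ2, n3]))
    (by rw [φ1, Category.comp_id])
    (hQ.hom_ext (by rw [Category.assoc, Category.assoc, φ1, sQ1, d1, Category.comp_id])
      (by rw [Category.assoc, Category.assoc, φ2, sQ2, Category.id_comp, n2]))
    hηK inferInstance
  exact IsPullback.of_iso_pullback ⟨n1.symm⟩ (asIso φ) φ2 φ1

lemma ne_comp (hC : IsHomological C) (tt : TorsionTheory C Tp Fp) (R : Reflection C Fp)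
    (hR : ∀ X : C, ∃ (K : C) (k : K ⟶ X), Tp K ∧ IsShortExact k (R.η.app X))
    (hP : IsProtoadditive R.F) {A B D : C} {f : A ⟶ B} {g : B ⟶ D}
    (hf : IsNormalExt R f) (hg : IsNormalExt R g) : IsNormalExt R (f ≫ g) := by
  obtain ⟨K, k, hk⟩ := exists_kernel hC (f ≫ g)
  obtain ⟨Kf, kf, hkf⟩ := exists_kernel hC f
  obtain ⟨Kg, kg, hkg⟩ := exists_kernel hC g
  have hKf := ne_ker tt R hR hf hkf
  have hKg := ne_ker tt R hR hg hkg
  have := hk.mono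
  refine ne_of_ker hC R hP (ed_comp hC hf.1 hg.1) hk (fp_of_zero tt R hR (fun T t hT => ?_))
  obtain ⟨r, hr⟩ := ker_map hk hkg rfl
  have h1 : (t ≫ k) ≫ f = 0 := by
    rw [Category.assoc, ← hr, ← Category.assoc, tt.hom_zero (t ≫ r) hT hKg, zero_comp]
  obtain ⟨l, hl⟩ := hkf.lift _ h1
  rw [← cancel_mono k, ← hl, tt.hom_zero l hT hKf, zero_comp, zero_comp]

lemma fac_exists (hC : IsHomological C) (tt : TorsionTheory C Tp Fp) (R : Reflection C Fp)
    (hR : ∀ X : C, ∃ (K : C) (k : K ⟶ X), Tp K ∧ IsShortExact k (R.η.app X))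
    (hN : ConditionN R) {A B : C} {f : A ⟶ B} (hf : IsEffectiveDescent f) :
    ∃ (I : C) (e : A ⟶ I) (m : I ⟶ B), e ≫ m = f ∧ StrongEpi e ∧
      (∃ (T : C) (j : T ⟶ A), IsKernelOf j e ∧ Tp T) ∧ IsEffectiveDescent m ∧
      (∃ (K : C) (k : K ⟶ I), IsKernelOf k m ∧ Fp K) := by
  obtain ⟨K, k, hk⟩ := exists_kernel hC f
  obtain ⟨T, t, hT, hs⟩ := hR K
  obtain ⟨G, g, hg⟩ := hN f k hk t hs.isKernel
  obtain ⟨I, e, i, he, hi, fac⟩ := hC.regEpiMonoFac g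
  have hse := strongEpi_of_re he
  have := hk.mono
  have := hs.isKernel.mono
  have hmono := hg.mono
  have hke : IsKernelOf (t ≫ k) e := by
    refine isKernelOf_mk _ _ ?_ (fun S x hx => hg.lift x ?_)
    · rw [← cancel_mono i, Category.assoc, fac, hg.w, zero_comp]
    · rw [← fac, reassoc_of% hx, zero_comp]
  have hco := coker_of_kernel hC hke
  obtain ⟨m, hm⟩ := hco.desc f (by rw [Category.assoc, hk.w, comp_zero])
  refine ⟨I, e, m, hm, hse, ⟨T, t ≫ k, hke, hT⟩, ed_cancel (f := e) hC (by rwa [hm]), ?_⟩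
  obtain ⟨K', k', hk'⟩ := exists_kernel hC m
  refine ⟨K', k', hk', ?_⟩
  have := hk'.mono
  obtain ⟨r, hr⟩ := ker_map hk hk' hm
  have hpb : IsPullback r k k' e := ker_pb (by rwa [hm]) hk' hr
  have : StrongEpi r := hC.strongEpi_fst hpb
  have htr : t ≫ r = 0 := by
    rw [← cancel_mono k', Category.assoc, hr, ← Category.assoc, hke.w, zero_comp]
  have hkr : IsKernelOf t r := by
    refine isKernelOf_mk _ _ htr (fun S x hx => ?_)
    obtain ⟨l, hl⟩ := hke.lift (x ≫ k) (by rw [Category.assoc, ← hr, reassoc_of% hx, zero_comp])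
    exact ⟨l, by rw [← cancel_mono k, Category.assoc, hl]⟩
  let ηK : K ⟶ R.F.obj K := R.η.app K
  have hη : IsCokernelOf ηK t := hs.isCokernel
  have := hη.epi
  obtain ⟨a, ha⟩ := (coker_of_kernel hC hkr).desc ηK hη.1
  obtain ⟨b, hb⟩ := hη.desc r htr
  refine tt.repleteF (R.mem K) ⟨b, a, ?_, ?_⟩
  · rw [← cancel_epi ηK, reassoc_of% hb, ha, Category.comp_id]
  · rw [← cancel_epi r, reassoc_of% ha, hb, Category.comp_id]

lemma orth (hC : IsHomological C) (tt : TorsionTheory C Tp Fp)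
    {A I X Y T K : C} {e : A ⟶ I} [StrongEpi e] {j : T ⟶ A} (hj : IsKernelOf j e) (hT : Tp T)
    {g : X ⟶ Y} {k : K ⟶ X} (hk : IsKernelOf k g) (hK : Fp K) (a : A ⟶ X) (b : I ⟶ Y)
    (h : e ≫ b = a ≫ g) : ∃ d : I ⟶ X, e ≫ d = a ∧ b = d ≫ g := by
  obtain ⟨l, hl⟩ := hk.lift (j ≫ a) (by rw [Category.assoc, ← h, ← Category.assoc, hj.w, zero_comp])
  obtain ⟨d, hd⟩ := (coker_of_kernel hC hj).desc a
    (by rw [← hl, tt.hom_zero l hT hK, zero_comp])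
  exact ⟨d, hd, by rw [← cancel_epi e, h, reassoc_of% hd]⟩

lemma iso_of_kernels (hC : IsHomological C) {I I' B K K' : C} {m : I ⟶ B} {m' : I' ⟶ B}
    {h : I ⟶ I'} (hh : h ≫ m' = m) (hm : IsEffectiveDescent m) {k : K ⟶ I} {k' : K' ⟶ I'}
    (hk : IsKernelOf k m) (hk' : IsKernelOf k' m') (κ : K ⟶ K') (hκ : κ ≫ k' = k ≫ h)
    (hi : IsIso κ) : IsIso h := by
  have P := IsPullback.of_hasPullback m m
  have P' := IsPullback.of_hasPullback m m'
  let α : pullback m m ⟶ pullback m m' := P'.lift (pullback.fst m m) (pullback.snd m m ≫ h) (by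
    rw [Category.assoc, hh, P.w])
  have α1 : α ≫ pullback.fst m m' = pullback.fst m m := P'.lift_fst _ _ _
  have α2 : α ≫ pullback.snd m m' = pullback.snd m m ≫ h := P'.lift_snd _ _ _
  let u : K ⟶ pullback m m := P.lift 0 k (by rw [zero_comp, hk.w])
  have u1 : u ≫ pullback.fst m m = 0 := P.lift_fst _ _ _
  have u2 : u ≫ pullback.snd m m = k := P.lift_snd _ _ _
  let u' : K' ⟶ pullback m m' := P'.lift 0 k' (by rw [zero_comp, hk'.w])
  have u1' : u' ≫ pullback.fst m m' = 0 := P'.lift_fst _ _ _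
  have u2' : u' ≫ pullback.snd m m' = k' := P'.lift_snd _ _ _
  let d : I ⟶ pullback m m := P.lift (𝟙 I) (𝟙 I) rfl
  have d1 : d ≫ pullback.fst m m = 𝟙 I := P.lift_fst _ _ _
  have d2 : d ≫ pullback.snd m m = 𝟙 I := P.lift_snd _ _ _
  let d' : I ⟶ pullback m m' := P'.lift (𝟙 I) h (by rw [Category.id_comp, hh])
  have d1' : d' ≫ pullback.fst m m' = 𝟙 I := P'.lift_fst _ _ _
  have d2' : d' ≫ pullback.snd m m' = h := P'.lift_snd _ _ _
  have hα : IsIso α := hC.protomodular u (pullback.fst m m) d u' (pullback.fst m m') d' κ α (𝟙 I)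
    ⟨ker_fst P hk u1 u2, d1⟩ ⟨ker_fst P' hk' u1' u2', d1'⟩
    (P'.hom_ext (by rw [Category.assoc, Category.assoc, α1, u1, u1', comp_zero])
      (by rw [Category.assoc, Category.assoc, α2, u2', reassoc_of% u2, hκ]))
    (by rw [Category.comp_id, α1])
    (P'.hom_ext (by rw [Category.assoc, Category.assoc, α1, d1, d1', Category.comp_id])
      (by rw [Category.assoc, Category.assoc, α2, d2', reassoc_of% d2, Category.id_comp]))
    hi inferInstance
  refine ed_conservative hm h m' (fun S s a b hs hab => ?_) (fun S s t hs => ?_)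
  · have hsa : s ≫ m = a ≫ m := by rw [hs, hh]
    have hsb : s ≫ m = b ≫ m := by rw [hs, reassoc_of% hab, hh]
    have key : P.lift s a hsa = P.lift s b hsb := by
      rw [← cancel_mono α]
      apply P'.hom_ext
      · rw [Category.assoc, Category.assoc, α1, P.lift_fst, P.lift_fst]
      · rw [Category.assoc, Category.assoc, α2, P.lift_snd_assoc, P.lift_snd_assoc, hab]
    rw [← P.lift_snd s a hsa, key, P.lift_snd]
  · refine ⟨P'.lift s t hs ≫ inv α ≫ pullback.snd m m, ?_⟩
    rw [Category.assoc, Category.assoc, ← α2, IsIso.inv_hom_id_assoc, P'.lift_snd]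

end Torsion

/-- Theorem 3.5. Let `(Tp, Fp)` be a torsion theory in a homological
category satisfying conditions (P) and (N). Then: (1) the normal extensions form a
reflective subcategory of the category of effective descent morphisms (the unit at
`f : A ⟶ B` being of the form `(e, 𝟙 B)`); (2) normal extensions are stable under
composition; (3) every effective descent morphism factors, uniquely up to isomorphism,
as a morphism stably inverted by the reflector followed by a normal extension, and
this factorisation coincides with the `(Ē, M̄)`-factorisation. -/
theorem statement13 {C : Type u} [Category.{v} C] [HasZeroObject C] [HasZeroMorphisms C]
    [HasPullbacks C]
    (hC : IsHomological C) {Tp Fp : C → Prop} (tt : TorsionTheory C Tp Fp)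
    (R : Reflection C Fp)
    (hR : ∀ X : C, ∃ (K : C) (k : K ⟶ X), Tp K ∧ IsShortExact k (R.η.app X))
    (hP : IsProtoadditive R.F) (hN : ConditionN R) :
    (∀ ⦃A B : C⦄ (f : A ⟶ B), IsEffectiveDescent f →
      ∃ (A' : C) (e : A ⟶ A') (m : A' ⟶ B), IsNormalExt R m ∧ e ≫ m = f ∧
        ∀ ⦃X Y : C⦄ (g : X ⟶ Y), IsNormalExt R g →
          ∀ (a : A ⟶ X) (b : B ⟶ Y), f ≫ b = a ≫ g →
            ∃! p : A' ⟶ X, e ≫ p = a ∧ m ≫ b = p ≫ g)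
    ∧ (∀ ⦃A B D : C⦄ (f : A ⟶ B) (g : B ⟶ D),
        IsNormalExt R f → IsNormalExt R g → IsNormalExt R (f ≫ g))
    ∧ (∀ ⦃A B : C⦄ (f : A ⟶ B), IsEffectiveDescent f →
        ∃ (I : C) (e : A ⟶ I) (m : I ⟶ B),
          e ≫ m = f ∧ StablyIn (invertedByR R) e ∧ IsNormalExt R m ∧
          Ebar Tp e ∧ Mbar Fp m ∧
          ∀ (I' : C) (e' : A ⟶ I') (m' : I' ⟶ B),
            e' ≫ m' = f → StablyIn (invertedByR R) e' → IsNormalExt R m' →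
            ∃ h : I ≅ I', e ≫ h.hom = e' ∧ h.hom ≫ m' = m) := by
  refine ⟨?_, fun A B D f g hf hg => ne_comp hC tt R hR hP hf hg, ?_⟩
  · intro A B f hf
    obtain ⟨I, e, m, hem, he, ⟨T, j, hj, hT⟩, hm, ⟨K, k, hk, hK⟩⟩ := fac_exists hC tt R hR hN hf
    refine ⟨I, e, m, ne_of_ker hC R hP hm hk hK, hem, ?_⟩
    intro X Y g hg a b hab
    obtain ⟨Kg, kg, hkg⟩ := exists_kernel hC g
    obtain ⟨d, hd1, hd2⟩ := orth hC tt hj hT hkg (ne_ker tt R hR hg hkg) a (m ≫ b)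
      (by rw [← Category.assoc, hem, hab])
    refine ⟨d, ⟨hd1, hd2⟩, fun d' hd' => ?_⟩
    rw [← cancel_epi e, hd1, hd'.1]
  · intro A B f hf
    obtain ⟨I, e, m, hem, he, ⟨T, j, hj, hT⟩, hm, ⟨K, k, hk, hK⟩⟩ := fac_exists hC tt R hR hN hf
    have hst : StablyIn (invertedByR R) e := stably_of_torsion hC tt R hj hT
    refine ⟨I, e, m, hem, hst, ne_of_ker hC R hP hm hk hK,
      ⟨⟨T, j, coker_of_kernel hC hj⟩, T, j, hj, hT⟩, ⟨K, k, hk, hK⟩, ?_⟩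
    intro I' e' m' hem' hst' hm'
    obtain ⟨K', k', hk'⟩ := exists_kernel hC m'
    have hK' := ne_ker tt R hR hm' hk'
    obtain ⟨h, hh1, hh2⟩ := orth hC tt hj hT hk' hK' e' m (by rw [hem, hem'])
    obtain ⟨κ, hκ⟩ := ker_map hk hk' hh2.symm
    obtain ⟨K0, k0, hk0⟩ := exists_kernel hC f
    obtain ⟨r, hr⟩ := ker_map hk0 hk hem
    obtain ⟨r', hr'⟩ := ker_map hk0 hk' hem'
    have hmk' := hk'.mono
    have hrr : r ≫ κ = r' := by
      rw [← cancel_mono k', Category.assoc, hκ, reassoc_of% hr, hh1, hr']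
    have i1 : IsIso (R.F.map r) := hst _ _ _ (ker_pb (by rwa [hem]) hk hr)
    have i2 : IsIso (R.F.map r') := hst' _ _ _ (ker_pb (by rwa [hem']) hk' hr')
    have i3 : IsIso (R.F.map r ≫ R.F.map κ) := by rw [← R.F.map_comp, hrr]; exact i2
    have i4 : IsIso (R.F.map κ) := IsIso.of_isIso_comp_left (R.F.map r) _
    have i5 : IsIso (R.η.app K) := eta_iso R hK
    have i6 : IsIso (R.η.app K') := eta_iso R hK'
    have i7 : IsIso (R.η.app K ≫ R.F.map κ) := inferInstance
    rw [← eta_nat] at i7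
    have i8 : IsIso κ := @IsIso.of_isIso_comp_right _ _ _ _ _ κ (R.η.app K') i6 i7
    have i9 : IsIso h := iso_of_kernels hC hh2.symm hm hk hk' κ hκ i8
    exact ⟨asIso h, hh1, hh2.symm⟩


end ProtoPaper
end

section
/- Let A be a pointed category and (E, M) the reflective prefactorisation system associated with a reflection F : A → F onto a full replete subcategory F. If for every object A of A the unique morphism A → 0 admits a factorisation A → 0 = m ∘ e with e ∈ E' and m ∈ M*, then F has stable units. In particular, F has stable units whenever (E', M*) is a factorisation system. -/
open CategoryTheory CategoryTheory.Limits

universe v u v₂ u₂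

namespace ProtoPaper

variable {C : Type u} [Category.{v} C]

variable {P : C → Prop}

open ZeroObject in
/-- If `m : I ⟶ 0` is locally in `E^↓`, then `I` is orthogonal to every member of `E`. -/
lemma orth_of_locallyIn {C : Type u} [Category.{v} C] [HasZeroObject C] [HasZeroMorphisms C]
    [HasPullbacks C] (W : MorphismProperty C) {I : C} (m : I ⟶ (0 : C))
    (hm : locallyIn (dnOrth W) m) {A B : C} (e : A ⟶ B) (he : W e) (a : A ⟶ I) :
    ∃! d : B ⟶ I, e ≫ d = a := by
  obtain ⟨E, p, -, Pb, p1, p2, hpb, hM⟩ := hm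
  have hz : ∀ {Z : C} (c : Z ⟶ I), (0 : Z ⟶ E) ≫ p = c ≫ m := fun c =>
    HasZeroObject.to_zero_ext _ _
  obtain ⟨d, ⟨hd1, hd2⟩, hu⟩ := hM e he (hpb.lift 0 a (hz a)) 0 (by simp)
  refine ⟨d ≫ p2, ?_, ?_⟩
  · change e ≫ d ≫ p2 = a
    rw [← Category.assoc, hd1, hpb.lift_snd]
  · intro d' hd'
    have hd'' : e ≫ d' = a := hd'
    have := hu (hpb.lift 0 d' (hz d')) ⟨by
      apply hpb.hom_ext
      · simp
      · simp [hd''], by simp⟩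
    rw [← this, hpb.lift_snd]

lemma Reflection.hom_ext {C : Type u} [Category.{v} C] {P : C → Prop} (R : Reflection C P)
    {X B : C} (hB : P B) {f g : R.F.obj X ⟶ B} (h : R.η.app X ≫ f = R.η.app X ≫ g) : f = g :=
  (R.univ hB _).unique h rfl

lemma Reflection.isIso_unit {C : Type u} [Category.{v} C] {P : C → Prop} (R : Reflection C P)
    {X : C} (d : R.F.obj X ⟶ X) (hd : R.η.app X ≫ d = 𝟙 X) : IsIso (R.η.app X) := by
  refine ⟨d, hd, R.hom_ext (R.mem X) ?_⟩
  have : (R.η.app X ≫ d) ≫ R.η.app X = R.η.app X := by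
    rw [hd]; exact Category.id_comp _
  simpa using this

lemma Reflection.isIso_map_unit {C : Type u} [Category.{v} C] {P : C → Prop}
    (R : Reflection C P) (A : C) : IsIso (R.F.map (R.η.app A)) := by
  have h : R.F.map (R.η.app A) = R.η.app (R.F.obj A) :=
    R.hom_ext (R.mem _) (R.η.naturality (R.η.app A)).symm
  obtain ⟨d, hd, -⟩ := R.univ (R.mem A) (𝟙 (R.F.obj A))
  rw [h]
  exact R.isIso_unit d hd

open ZeroObject in
lemma stableUnits_of_fac {C : Type u} [Category.{v} C] [HasZeroObject C] [HasZeroMorphisms C]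
    [HasPullbacks C] {P : C → Prop} (R : Reflection C P)
    (H : ∀ A : C, ∃ (I : C) (e : A ⟶ I) (m : I ⟶ (0 : C)),
        StablyIn (invertedByR R) e ∧ locallyIn (dnOrth (invertedByR R)) m) :
    StableUnits R := by
  intro A X Pb x p1 p2 hpb
  obtain ⟨I, e, m, he, hm⟩ := H A
  obtain ⟨d, hd, -⟩ := orth_of_locallyIn _ m hm (R.η.app I) (R.isIso_map_unit I) (𝟙 I)
  have hI : IsIso (R.η.app I) := R.isIso_unit d hd
  have hFe : IsIso (R.F.map e) := he e (𝟙 A) (𝟙 I) (IsPullback.of_vert_isIso ⟨by simp⟩)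
  let i : R.F.obj A ≅ I := asIso (R.F.map e) ≪≫ (asIso (R.η.app I)).symm
  have hi : R.η.app A ≫ i.hom = e := by
    have := R.η.naturality e
    simp only [Functor.id_map] at this
    simp [i, ← reassoc_of% this]
  have hp : IsPullback p2 p1 (x ≫ i.hom) e := by
    rw [← hi]
    refine IsPullback.of_iso hpb.flip (Iso.refl _) (Iso.refl _) (Iso.refl _) i ?_ ?_ ?_ ?_ <;> simp
  have h2 : IsIso (R.F.map p2) := he p2 p1 _ hp
  have h1 := R.isIso_map_unit A
  refine (IsPullback.of_vert_isIso ⟨?_⟩)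
  rw [← R.F.map_comp, ← R.F.map_comp, hpb.w]

open ZeroObject in
/-- Proposition 3.6. Let `C` be a pointed category and `(E, M)` the
reflective prefactorisation system of a reflection `R` (so `E` is the class of
morphisms inverted by the reflector and `M = E^↓`). If the unique morphism `A ⟶ 0`
of every object admits an `(E', M*)`-factorisation — where `E'` consists of the
morphisms stably in `E` and `M*` of the morphisms locally in `M` — then the reflector
has stable units. In particular, this holds whenever `(E', M*)` is a factorisation
system. -/
theorem statement14 {C : Type u} [Category.{v} C] [HasZeroObject C] [HasZeroMorphisms C]
    [HasPullbacks C]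
    {P : C → Prop} (hrepl : Replete P) (R : Reflection C P) :
    ((∀ A : C, ∃ (I : C) (e : A ⟶ I) (m : I ⟶ (0 : C)),
        StablyIn (invertedByR R) e ∧ locallyIn (dnOrth (invertedByR R)) m ∧
        e ≫ m = (0 : A ⟶ (0 : C))) →
      StableUnits R)
    ∧ (IsFactorisationSystem (StablyIn (invertedByR R))
        (locallyIn (dnOrth (invertedByR R))) →
      StableUnits R) := by
  refine ⟨fun H => stableUnits_of_fac R fun A => ?_, fun H => stableUnits_of_fac R fun A => ?_⟩
  · obtain ⟨I, e, m, he, hm, -⟩ := H A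
    exact ⟨I, e, m, he, hm⟩
  · obtain ⟨I, e, m, he, hm, -⟩ := H.fac (0 : A ⟶ (0 : C))
    exact ⟨I, e, m, he, hm⟩

end ProtoPaper
end

section
/- Let A be a homological category and (T, F) a torsion theory in A satisfying condition (N). Then the pair (T₁, F₁) is a torsion theory in the arrow category Arr(A) satisfying condition (N), where F₁ is the full subcategory of Arr(A) consisting of all morphisms f with K[f] ∈ F, and T₁ is the full subcategory of Arr(A) consisting of all morphisms of the form T → 0 with T ∈ T. If (T, F) satisfies, in addition, condition (P), then (T₁, F₁) satisfies condition (P) as well. -/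
open CategoryTheory CategoryTheory.Limits

universe v u v₂ u₂

namespace ProtoPaper

variable {C : Type u} [Category.{v} C]

variable {P : C → Prop}

section Helpers

lemma ker_iff [HasZeroMorphisms C] {K A B : C} {k : K ⟶ A} {f : A ⟶ B} :
    IsKernelOf k f ↔ k ≫ f = 0 ∧ Mono k ∧
      ∀ ⦃W : C⦄ (z : W ⟶ A), z ≫ f = 0 → ∃ w : W ⟶ K, w ≫ k = z := by
  constructor
  · rintro ⟨w, ⟨h⟩⟩
    refine ⟨w, ⟨fun a b hab => Fork.IsLimit.hom_ext h hab⟩, fun W z hz => ?_⟩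
    exact ⟨(KernelFork.IsLimit.lift' h z hz).1, (KernelFork.IsLimit.lift' h z hz).2⟩
  · rintro ⟨w, hm, h⟩
    refine ⟨w, ⟨KernelFork.IsLimit.ofι' k w fun z hz => ⟨(h z hz).choose, (h z hz).choose_spec⟩⟩⟩

lemma coker_iff [HasZeroMorphisms C] {K A B : C} {k : K ⟶ A} {f : A ⟶ B} :
    IsCokernelOf f k ↔ k ≫ f = 0 ∧ Epi f ∧
      ∀ ⦃W : C⦄ (z : A ⟶ W), k ≫ z = 0 → ∃ w : B ⟶ W, f ≫ w = z := by
  constructor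
  · rintro ⟨w, ⟨h⟩⟩
    refine ⟨w, ⟨fun a b hab => Cofork.IsColimit.hom_ext h hab⟩, fun W z hz => ?_⟩
    exact ⟨(CokernelCofork.IsColimit.desc' h z hz).1, (CokernelCofork.IsColimit.desc' h z hz).2⟩
  · rintro ⟨w, hm, h⟩
    refine ⟨w, ⟨CokernelCofork.IsColimit.ofπ' f w
      fun z hz => ⟨(h z hz).choose, (h z hz).choose_spec⟩⟩⟩

lemma exists_ker [HasZeroMorphisms C] [HasZeroObject C] (hC : IsHomological C) {A B : C}
    (f : A ⟶ B) : ∃ (K : C) (k : K ⟶ A), IsKernelOf k f := by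
  have := hC.hasFiniteLimits
  exact ⟨kernel f, kernel.ι f, ker_iff.2 ⟨kernel.condition f, inferInstance,
    fun W z hz => ⟨kernel.lift f z hz, kernel.lift_ι _ _ _⟩⟩⟩

/-- Kernel and section of a split epimorphism are jointly strongly epic. -/
lemma joint_iso [HasZeroMorphisms C] (hC : IsProtomodular C) {K A B M : C}
    {k : K ⟶ A} {f : A ⟶ B} {s : B ⟶ A} (h : IsSplitShortExact k f s) (m : M ⟶ A) [Mono m]
    (k' : K ⟶ M) (hk : k' ≫ m = k) (s' : B ⟶ M) (hs : s' ≫ m = s) : IsIso m := by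
  obtain ⟨h1, h2, h3⟩ := ker_iff.1 h.isKernel
  refine hC k' (m ≫ f) s' k f s (𝟙 K) m (𝟙 B) ⟨ker_iff.2 ⟨?_, ?_, ?_⟩, ?_⟩ h ?_ ?_ ?_
    inferInstance inferInstance
  · rw [← Category.assoc, hk, h1]
  · subst hk
    exact mono_of_mono k' m
  · intro W z hz
    obtain ⟨w, hw⟩ := h3 (z ≫ m) (by simpa using hz)
    refine ⟨w, ?_⟩
    rw [← cancel_mono m, Category.assoc, hk, hw]
  · rw [← Category.assoc, hs, h.split]
  · simpa using hk
  · simp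
  · simpa using hs

lemma regEpi_of_strong [HasZeroMorphisms C] [HasZeroObject C] (hC : IsHomological C) {A B : C}
    (f : A ⟶ B) [StrongEpi f] : Nonempty (RegularEpi f) := by
  obtain ⟨I, e, m, ⟨he⟩, hm, rfl⟩ := hC.regEpiMonoFac f
  have : StrongEpi m := strongEpi_of_strongEpi e m
  have := isIso_of_mono_of_strongEpi m
  exact ⟨RegularEpi.ofArrowIso (f := e) (g := e ≫ m)
    (Arrow.isoMk' e (e ≫ m) (Iso.refl _) (asIso m) (by simp)) he⟩

lemma strong_of_regEpi {A B : C} {f : A ⟶ B} (h : Nonempty (RegularEpi f)) : StrongEpi f := by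
  obtain ⟨h⟩ := h
  have := isRegularEpi_of_regularEpi h
  infer_instance

lemma strong_fac [HasZeroMorphisms C] [HasZeroObject C] (hC : IsHomological C) {A B : C}
    (f : A ⟶ B) : ∃ (I : C) (e : A ⟶ I) (m : I ⟶ B), StrongEpi e ∧ Mono m ∧ e ≫ m = f := by
  obtain ⟨I, e, m, he, hm, h⟩ := hC.regEpiMonoFac f
  exact ⟨I, e, m, strong_of_regEpi he, hm, h⟩

lemma strong_pb [HasZeroMorphisms C] [HasZeroObject C] (hC : IsHomological C) {P X Y Z : C}
    {fst : P ⟶ X} {snd : P ⟶ Y} {f : X ⟶ Z} {g : Y ⟶ Z}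
    (h : IsPullback fst snd f g) [StrongEpi f] : StrongEpi snd :=
  strong_of_regEpi (hC.regEpiStable fst snd f g h (regEpi_of_strong hC f))

/-- A convenient way to build pullbacks along monomorphisms. -/
lemma isPullback_mk {P X Y Z : C} {fst : P ⟶ X} {snd : P ⟶ Y} {f : X ⟶ Z} {g : Y ⟶ Z}
    (w : fst ≫ f = snd ≫ g) [Mono fst]
    (h : ∀ ⦃W : C⦄ (a : W ⟶ X) (b : W ⟶ Y), a ≫ f = b ≫ g → ∃ l : W ⟶ P, l ≫ fst = a ∧ l ≫ snd = b) :
    IsPullback fst snd f g :=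
  ⟨⟨w⟩, ⟨PullbackCone.IsLimit.mk w (fun s => (h s.fst s.snd s.condition).choose)
    (fun s => (h s.fst s.snd s.condition).choose_spec.1)
    (fun s => (h s.fst s.snd s.condition).choose_spec.2)
    (fun s m h1 _ => by
      rw [← cancel_mono fst, h1, (h s.fst s.snd s.condition).choose_spec.1])⟩⟩

lemma exists_pb [HasZeroMorphisms C] [HasZeroObject C] (hC : IsHomological C) {X Y Z : C}
    (f : X ⟶ Z) (g : Y ⟶ Z) : ∃ (P : C) (p₁ : P ⟶ X) (p₂ : P ⟶ Y), IsPullback p₁ p₂ f g := by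
  have := hC.hasFiniteLimits
  exact ⟨_, _, _, IsPullback.of_hasPullback f g⟩

lemma pb_split [HasZeroMorphisms C] {P X Y Z K : C} {p₁ : P ⟶ X} {p₂ : P ⟶ Y}
    {f : X ⟶ Z} {g : Y ⟶ Z} (hP : IsPullback p₁ p₂ f g) {k : K ⟶ Y} (hk : IsKernelOf k g)
    (s : X ⟶ Y) (hs : s ≫ g = f) {k' : K ⟶ P} (hk1 : k' ≫ p₁ = 0) (hk2 : k' ≫ p₂ = k)
    {s' : X ⟶ P} (hs1 : s' ≫ p₁ = 𝟙 X) : IsSplitShortExact k' p₁ s' := by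
  obtain ⟨h1, h2, h3⟩ := ker_iff.1 hk
  refine ⟨ker_iff.2 ⟨hk1, ?_, ?_⟩, hs1⟩
  · subst hk2
    exact mono_of_mono _ p₂
  · intro W z hz
    obtain ⟨w, hw⟩ := h3 (z ≫ p₂) (by
      rw [Category.assoc, ← hP.w, ← Category.assoc, hz, zero_comp])
    refine ⟨w, hP.hom_ext ?_ ?_⟩
    · rw [Category.assoc, hk1, hz, comp_zero]
    · rw [Category.assoc, hk2, hw]

/-- In a homological category, strong epimorphisms are cokernels of their kernels. -/
lemma coker_of_strong [HasZeroMorphisms C] [HasZeroObject C] (hC : IsHomological C) {K X Q : C}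
    {k : K ⟶ X} {e : X ⟶ Q} [StrongEpi e] (hk : IsKernelOf k e) : IsCokernelOf e k := by
  have := hC.hasFiniteLimits
  obtain ⟨h1, h2, h3⟩ := ker_iff.1 hk
  obtain ⟨he⟩ := regEpi_of_strong hC e
  refine coker_iff.2 ⟨h1, inferInstance, fun W g hg => ?_⟩
  obtain ⟨P, p₁, p₂, hP⟩ := exists_pb hC e e
  obtain ⟨k', hk1, hk2⟩ := hP.exists_lift (0 : K ⟶ X) k (by rw [h1, zero_comp])
  obtain ⟨s', hs1, hs2⟩ := hP.exists_lift (𝟙 X) (𝟙 X) rfl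
  have key : p₁ ≫ g = p₂ ≫ g := by
    have hs := pb_split hP hk (𝟙 X) (Category.id_comp e) hk1 hk2 hs1
    have := joint_iso hC.protomodular hs (equalizer.ι (p₁ ≫ g) (p₂ ≫ g))
      (equalizer.lift k' (by
        rw [← Category.assoc, ← Category.assoc, hk1, hk2, hg, zero_comp])) (equalizer.lift_ι _ _)
      (equalizer.lift s' (by
        rw [← Category.assoc, ← Category.assoc, hs1, hs2])) (equalizer.lift_ι _ _)
    rw [← cancel_epi (equalizer.ι (p₁ ≫ g) (p₂ ≫ g))]
    exact equalizer.condition _ _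
  obtain ⟨l, hl1, hl2⟩ := hP.exists_lift he.left he.right he.w
  have := RegularEpi.desc' he g (by
    rw [← hl1, ← hl2, Category.assoc, Category.assoc, key])
  exact ⟨this.1, this.2⟩

/-- A version of the short five lemma. -/
lemma short_five [HasZeroMorphisms C] [HasZeroObject C] (hC : IsHomological C) {X Y Q : C}
    (φ : X ⟶ Y) (r : Y ⟶ Q) [Mono φ] [StrongEpi (φ ≫ r)]
    (h : ∀ ⦃W : C⦄ (z : W ⟶ Y), z ≫ r = 0 → ∃ w : W ⟶ X, w ≫ φ = z) : IsIso φ := by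
  obtain ⟨K, k, hk⟩ := exists_ker hC r
  obtain ⟨h1, h2, h3⟩ := ker_iff.1 hk
  obtain ⟨k₀, hk₀⟩ := h k h1
  obtain ⟨P, p₁, p₂, hP⟩ := exists_pb hC (φ ≫ r) r
  obtain ⟨k', hk1, hk2⟩ := hP.exists_lift (0 : K ⟶ X) k (by rw [h1, zero_comp])
  obtain ⟨s', hs1, hs2⟩ := hP.exists_lift (𝟙 X) φ (Category.id_comp _)
  have hs := pb_split hP hk φ rfl hk1 hk2 hs1
  obtain ⟨M, m, n, hM⟩ := exists_pb hC p₂ φ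
  have : Mono m := ⟨fun a b hab => hM.hom_ext hab (by
    rw [← cancel_mono φ, Category.assoc, Category.assoc, ← hM.w, ← Category.assoc, hab,
      Category.assoc])⟩
  obtain ⟨k'', hk1', -⟩ := hM.exists_lift k' k₀ (by rw [hk2, hk₀])
  obtain ⟨s'', hs1', -⟩ := hM.exists_lift s' (𝟙 X) (by rw [hs2, Category.id_comp])
  have := joint_iso hC.protomodular hs m k'' hk1' s'' hs1'
  have : StrongEpi p₂ := strong_pb hC hP
  have : StrongEpi ((inv m ≫ n) ≫ φ) := by
    rw [Category.assoc, ← hM.w]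
    simpa
  have := strongEpi_of_strongEpi (inv m ≫ n) φ
  exact isIso_of_mono_of_strongEpi φ

lemma coker_unique [HasZeroMorphisms C] {K A B B' : C} {k : K ⟶ A} {f : A ⟶ B} {f' : A ⟶ B'}
    (h : IsCokernelOf f k) (h' : IsCokernelOf f' k) (c : B ⟶ B') (hc : f ≫ c = f') : IsIso c := by
  obtain ⟨h1, h2, h3⟩ := coker_iff.1 h
  obtain ⟨h1', h2', h3'⟩ := coker_iff.1 h'
  obtain ⟨d, hd⟩ := h3' f h1
  refine ⟨d, ?_, ?_⟩
  · rw [← cancel_epi f, ← Category.assoc, hc, hd, Category.comp_id]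
  · rw [← cancel_epi f', ← Category.assoc, hd, hc, Category.comp_id]

/-- The quotient of `A` by the torsion part of the kernel of `f`. -/
lemma tors_quot [HasZeroMorphisms C] [HasZeroObject C] (hC : IsHomological C)
    {Tp Fp : C → Prop} (tt : TorsionTheory C Tp Fp) (hN : TTConditionN Tp Fp)
    {A B L TL FL : C} {f : A ⟶ B} {k : L ⟶ A} {t : TL ⟶ L} {q : L ⟶ FL}
    (hk : IsKernelOf k f) (hT : Tp TL) (hF : Fp FL) (hs : IsShortExact t q) :
    ∃ (Q : C) (p : A ⟶ Q) (f' : Q ⟶ B), StrongEpi p ∧ IsKernelOf (t ≫ k) p ∧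
      IsCokernelOf p (t ≫ k) ∧ p ≫ f' = f ∧ ∃ (K' : C) (k' : K' ⟶ Q), IsKernelOf k' f' ∧ Fp K' := by
  obtain ⟨D, x, hx⟩ := hN f k t q hk hT hF hs
  obtain ⟨Q, p, m, hp, hm, hpm⟩ := strong_fac hC x
  have hker : IsKernelOf (t ≫ k) p := by
    obtain ⟨h1, h2, h3⟩ := ker_iff.1 hx
    refine ker_iff.2 ⟨?_, h2, fun W z hz => h3 z (by rw [← hpm, ← Category.assoc, hz, zero_comp])⟩
    rw [← cancel_mono m, Category.assoc, hpm, h1, zero_comp]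
  have hcok := coker_of_strong hC hker
  obtain ⟨k1, k2, k3⟩ := ker_iff.1 hk
  obtain ⟨a1, a2, a3⟩ := ker_iff.1 hker
  obtain ⟨t1, t2, t3⟩ := ker_iff.1 hs.isKernel
  obtain ⟨f', hf'⟩ := (coker_iff.1 hcok).2.2 f (by rw [Category.assoc, k1, comp_zero])
  obtain ⟨K', k', hk'⟩ := exists_ker hC f'
  obtain ⟨b1, b2, b3⟩ := ker_iff.1 hk'
  refine ⟨Q, p, f', hp, hker, hcok, hf', K', k', hk', ?_⟩
  obtain ⟨c, hc⟩ := b3 (k ≫ p) (by rw [Category.assoc, hf', k1])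
  have hpb : IsPullback k c p k' := by
    refine isPullback_mk hc.symm fun W a b hab => ?_
    obtain ⟨l, hl⟩ := k3 a (by
      rw [← hf', ← Category.assoc, hab, Category.assoc, b1, comp_zero])
    refine ⟨l, hl, ?_⟩
    rw [← cancel_mono k', Category.assoc, hc, ← Category.assoc, hl, hab]
  have : StrongEpi c := strong_pb hC hpb
  have htc : IsKernelOf t c := by
    refine ker_iff.2 ⟨?_, t2, fun W z hz => ?_⟩
    · rw [← cancel_mono k', Category.assoc, hc, ← Category.assoc, a1, zero_comp]
    · obtain ⟨w, hw⟩ := a3 (z ≫ k) (by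
        rw [Category.assoc, ← hc, ← Category.assoc, hz, zero_comp])
      exact ⟨w, by rw [← cancel_mono k, Category.assoc, hw]⟩
  have hcc := coker_of_strong hC htc
  obtain ⟨d, hd⟩ := (coker_iff.1 hs.isCokernel).2.2 c (coker_iff.1 hcc).1
  have := coker_unique hs.isCokernel hcc d hd
  exact tt.repleteF hF (asIso d)

section ArrowKer

variable [HasZeroMorphisms C]

lemma arrow_ker_mk {K A B : Arrow C} {k : K ⟶ A} {f : A ⟶ B} (hl : IsKernelOf k.left f.left)
    (hr : IsKernelOf k.right f.right) : IsKernelOf k f := by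
  obtain ⟨h1, h2, h3⟩ := ker_iff.1 hl
  obtain ⟨h1', h2', h3'⟩ := ker_iff.1 hr
  refine ker_iff.2 ⟨Arrow.hom_ext _ _ h1 h1', ⟨fun a b hab => ?_⟩, fun W z hz => ?_⟩
  · apply Arrow.hom_ext
    · rw [← cancel_mono k.left]; exact congrArg (fun x => x.left) hab
    · rw [← cancel_mono k.right]; exact congrArg (fun x => x.right) hab
  · obtain ⟨a, ha⟩ := h3 z.left (congrArg (fun x => x.left) hz)
    obtain ⟨b, hb⟩ := h3' z.right (congrArg (fun x => x.right) hz)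
    refine ⟨Arrow.homMk a b ?_, ?_⟩
    · rw [← cancel_mono k.right, Category.assoc, Category.assoc, hb, ← Arrow.w k,
        ← Category.assoc, ha, Arrow.w]
    · apply Arrow.hom_ext
      · exact ha
      · exact hb

lemma arrow_ker_left {K A B : Arrow C} {k : K ⟶ A} {f : A ⟶ B} (h : IsKernelOf k f) :
    IsKernelOf k.left f.left := by
  obtain ⟨h1, h2, h3⟩ := ker_iff.1 h
  refine ker_iff.2 ⟨congrArg (fun x => x.left) h1, ⟨fun {Z} a b hab => ?_⟩, fun W z hz => ?_⟩
  · have : (Arrow.homMk a (a ≫ K.hom) (by simp) : Arrow.mk (𝟙 Z) ⟶ K) =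
        Arrow.homMk b (b ≫ K.hom) (by simp) := by
      rw [← cancel_mono k]
      apply Arrow.hom_ext
      · exact hab
      · have := congrArg (fun x => x ≫ A.hom) hab
        simpa using this
    exact congrArg (fun x => x.left) this
  · obtain ⟨w, hw⟩ := h3 (Arrow.homMk z (z ≫ A.hom) (by simp) : Arrow.mk (𝟙 W) ⟶ A) (by
      apply Arrow.hom_ext
      · exact hz
      · have := congrArg (fun x => x ≫ B.hom) hz
        simpa using this)
    exact ⟨w.left, congrArg (fun x => x.left) hw⟩

lemma arrow_ker_right [HasZeroObject C] {K A B : Arrow C} {k : K ⟶ A} {f : A ⟶ B}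
    (h : IsKernelOf k f) : IsKernelOf k.right f.right := by
  obtain ⟨Z0, hZ⟩ := HasZeroObject.zero (C := C)
  obtain ⟨h1, h2, h3⟩ := ker_iff.1 h
  refine ker_iff.2 ⟨congrArg (fun x => x.right) h1, ⟨fun {Z} a b hab => ?_⟩, fun W z hz => ?_⟩
  · have : (Arrow.homMk 0 a (by simp) : Arrow.mk (0 : Z0 ⟶ Z) ⟶ K) =
        Arrow.homMk 0 b (by simp) := by
      rw [← cancel_mono k]
      apply Arrow.hom_ext
      · rfl
      · exact hab
    exact congrArg (fun x => x.right) this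
  · obtain ⟨w, hw⟩ := h3 (Arrow.homMk 0 z (by simp) : Arrow.mk (0 : Z0 ⟶ W) ⟶ A) (by
      apply Arrow.hom_ext
      · simp
      · exact hz)
    exact ⟨w.right, congrArg (fun x => x.right) hw⟩

end ArrowKer

end Helpers

section Main

variable [HasZeroObject C] [HasZeroMorphisms C]

abbrev TorsArrow (Tp : C → Prop) : Arrow C → Prop := fun g => Tp g.left ∧ IsZero g.right

abbrev FreeArrow (Fp : C → Prop) : Arrow C → Prop :=
  fun g => ∃ (K : C) (k : K ⟶ g.left), IsKernelOf k g.hom ∧ Fp K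

lemma arrow_hom_zero {Tp Fp : C → Prop} (tt : TorsionTheory C Tp Fp) {X Y : Arrow C}
    (f : X ⟶ Y) (hX : TorsArrow Tp X) (hY : FreeArrow Fp Y) : f = 0 := by
  obtain ⟨K, k, hk, hF⟩ := hY
  have hr : f.right = 0 := hX.2.eq_zero_of_src _
  obtain ⟨w, hw⟩ := (ker_iff.1 hk).2.2 f.left (by rw [Arrow.w f, hr, comp_zero])
  apply Arrow.hom_ext
  · rw [← hw, tt.hom_zero w hX.1 hF, zero_comp]; rfl
  · exact hr

/-- The torsion short exact sequence of an arrow. -/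
lemma arrow_ses (hC : IsHomological C)
    {Tp Fp : C → Prop} (tt : TorsionTheory C Tp Fp) (hN : TTConditionN Tp Fp)
    (f : Arrow C) {L TL FL : C} {k : L ⟶ f.left} {t : TL ⟶ L} {q : L ⟶ FL}
    (hk : IsKernelOf k f.hom) (hT : Tp TL) (hF : Fp FL) (hs : IsShortExact t q) :
    ∃ (T Q : Arrow C) (t' : T ⟶ f) (p : f ⟶ Q), TorsArrow Tp T ∧ FreeArrow Fp Q ∧
      IsShortExact t' p ∧ StrongEpi p.left ∧ IsIso p.right ∧ IsKernelOf (t ≫ k) p.left := by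
  obtain ⟨Z0, hZ⟩ := HasZeroObject.zero (C := C)
  obtain ⟨Q, p, f', hp, hker, hcok, hf', hQ⟩ := tors_quot hC tt hN hk hT hF hs
  obtain ⟨c1, c2, c3⟩ := coker_iff.1 hcok
  refine ⟨Arrow.mk (0 : TL ⟶ Z0), Arrow.mk f',
    Arrow.homMk (t ≫ k) 0 (by simp [(ker_iff.1 hk).1]), Arrow.homMk p (𝟙 _) (by simp [hf']),
    ⟨hT, hZ⟩, hQ, ⟨arrow_ker_mk hker ?_, ?_⟩, hp, ?_, hker⟩
  · refine ker_iff.2 ⟨by simp, ⟨fun a b _ => hZ.eq_of_tgt _ _⟩, fun W z hz => ⟨0, ?_⟩⟩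
    have : z = 0 := by simpa using hz
    rw [this, zero_comp]
  · refine coker_iff.2 ⟨?_, ⟨fun a b hab => ?_⟩, fun W z hz => ?_⟩
    · apply Arrow.hom_ext
      · exact c1
      · simp
    · apply Arrow.hom_ext
      · rw [← cancel_epi p]; exact congrArg (fun x => x.left) hab
      · have := congrArg (fun x => x.right) hab
        simpa using this
    · obtain ⟨w, hw⟩ := c3 z.left (congrArg (fun x => x.left) hz)
      refine ⟨Arrow.homMk w z.right ?_, ?_⟩
      · rw [← cancel_epi p, ← Category.assoc, hw, Arrow.w]
        simp [← hf']
      · apply Arrow.hom_ext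
        · exact hw
        · simp
  · exact (inferInstance : IsIso (𝟙 f.right))

lemma arrow_tt (hC : IsHomological C)
    {Tp Fp : C → Prop} (tt : TorsionTheory C Tp Fp) (hN : TTConditionN Tp Fp) :
    TorsionTheory (Arrow C) (TorsArrow Tp) (FreeArrow Fp) where
  repleteT X Y hX e := ⟨tt.repleteT hX.1 (Arrow.leftFunc.mapIso e),
    hX.2.of_iso (Arrow.rightFunc.mapIso e).symm⟩
  repleteF X Y hX e := by
    obtain ⟨K, k, hk, hF⟩ := hX
    obtain ⟨k1, k2, k3⟩ := ker_iff.1 hk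
    refine ⟨K, k ≫ e.hom.left, ker_iff.2 ⟨?_, inferInstance, fun W z hz => ?_⟩, hF⟩
    · rw [Category.assoc, Arrow.w, ← Category.assoc, k1, zero_comp]
    · obtain ⟨w, hw⟩ := k3 (z ≫ e.inv.left) (by
        rw [Category.assoc, Arrow.w, ← Category.assoc, hz, zero_comp])
      refine ⟨w, ?_⟩
      rw [← Category.assoc, hw, Category.assoc, Arrow.inv_hom_id_left, Category.comp_id]
  hom_zero X Y f hX hY := arrow_hom_zero tt f hX hY
  exists_ses f := by
    obtain ⟨L, k, hk⟩ := exists_ker hC f.hom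
    obtain ⟨TL, FL, t, q, hT, hF, hs⟩ := tt.exists_ses L
    obtain ⟨T, Q, t', p, h1, h2, h3, -⟩ := arrow_ses hC tt hN f hk hT hF hs
    exact ⟨T, Q, t', p, h1, h2, h3⟩

lemma exists_prod (hC : IsHomological C) (X Y : C) : ∃ (P : C) (p : P ⟶ X) (q : P ⟶ Y),
    (∀ ⦃W : C⦄ (a : W ⟶ X) (b : W ⟶ Y), ∃ l : W ⟶ P, l ≫ p = a ∧ l ≫ q = b) ∧
    (∀ ⦃W : C⦄ (a b : W ⟶ P), a ≫ p = b ≫ p → a ≫ q = b ≫ q → a = b) := by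
  have := hC.hasFiniteLimits
  exact ⟨X ⨯ Y, prod.fst, prod.snd,
    fun W a b => ⟨prod.lift a b, prod.lift_fst _ _, prod.lift_snd _ _⟩,
    fun W a b h1 h2 => Limits.prod.hom_ext h1 h2⟩

lemma arrow_N (hC : IsHomological C)
    {Tp Fp : C → Prop} (tt : TorsionTheory C Tp Fp) (hN : TTConditionN Tp Fp) :
    TTConditionN (C := Arrow C) (TorsArrow Tp) (FreeArrow Fp) := by
  intro A B K TK FK f k t q hk hT hF hs
  have := hC.hasFiniteLimits
  obtain ⟨a1, a2, a3⟩ := ker_iff.1 (arrow_ker_left hk)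
  obtain ⟨b1, b2, b3⟩ := ker_iff.1 (arrow_ker_right hk)
  obtain ⟨t1, t2, t3⟩ := ker_iff.1 hs.isKernel
  obtain ⟨tl1, tl2, tl3⟩ := ker_iff.1 (arrow_ker_left hs.isKernel)
  obtain ⟨L, l, hl⟩ := exists_ker hC K.hom
  obtain ⟨l1, l2, l3⟩ := ker_iff.1 hl
  obtain ⟨TL, FL, tL, qL, hTL, hFL, hsL⟩ := tt.exists_ses L
  obtain ⟨s1, s2, s3⟩ := ker_iff.1 hsL.isKernel
  -- `L` is the kernel of `(f.left, A.hom)`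
  obtain ⟨P, p₁, p₂, hPl, hPe⟩ := exists_prod hC B.left A.right
  obtain ⟨fA, hfA1, hfA2⟩ := hPl f.left A.hom
  have hker : IsKernelOf (l ≫ k.left) fA := by
    refine ker_iff.2 ⟨?_, inferInstance, fun W z hz => ?_⟩
    · apply hPe
      · simp [hfA1, a1]
      · simp [hfA2, reassoc_of% l1]
    · have z1 : z ≫ f.left = 0 := by rw [← hfA1, reassoc_of% hz, zero_comp]
      have z2 : z ≫ A.hom = 0 := by rw [← hfA2, reassoc_of% hz, zero_comp]
      obtain ⟨w, hw⟩ := a3 z z1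
      obtain ⟨w', hw'⟩ := l3 w (by
        rw [← cancel_mono k.right, Category.assoc, ← Arrow.w k, ← Category.assoc, hw, z2,
          zero_comp])
      exact ⟨w', by rw [← Category.assoc, hw', hw]⟩
  obtain ⟨X, x, hx⟩ := hN _ _ _ _ hker hTL hFL hsL
  obtain ⟨x1, x2, x3⟩ := ker_iff.1 hx
  have tz : t.left ≫ K.hom = 0 := by
    rw [Arrow.w t, hT.2.eq_zero_of_tgt TK.hom, zero_comp]
  -- comparison of the two torsion parts
  obtain ⟨t₀, ht₀⟩ := l3 t.left tz
  obtain ⟨u, hu⟩ := s3 t₀ (tt.hom_zero _ hT.1 hFL)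
  obtain ⟨Z0, hZ⟩ := HasZeroObject.zero (C := C)
  obtain ⟨v, hv⟩ := t3 (Arrow.homMk (tL ≫ l) 0 (by simp [l1]) : Arrow.mk (0 : TL ⟶ Z0) ⟶ K)
    (arrow_hom_zero tt _ ⟨hTL, hZ⟩ hF)
  have hv' : v.left ≫ t.left = tL ≫ l := congrArg (fun x => x.left) hv
  have hu' : u ≫ tL ≫ l = t.left := by rw [← Category.assoc, hu, ht₀]
  obtain ⟨P', p₁', p₂', hPl', hPe'⟩ := exists_prod hC X A.right
  obtain ⟨xA, hxA1, hxA2⟩ := hPl' x A.hom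
  refine ⟨Arrow.mk p₂', Arrow.homMk xA (𝟙 _) (by simp [hxA2]), arrow_ker_mk ?_ ?_⟩
  · refine ker_iff.2 ⟨?_, ?_, fun W z hz => ?_⟩
    · change (t.left ≫ k.left) ≫ xA = 0
      apply hPe'
      · rw [← hu']
        have : tL ≫ l ≫ k.left ≫ x = 0 := by simpa using x1
        simp [hxA1, this]
      · rw [Category.assoc, Category.assoc, hxA2, Arrow.w k, reassoc_of% tz, zero_comp, zero_comp]
    · exact (inferInstance : Mono (t.left ≫ k.left))
    · replace hz : z ≫ xA = 0 := hz
      have z1 : z ≫ x = 0 := by rw [← hxA1, reassoc_of% hz, zero_comp]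
      obtain ⟨w, hw⟩ := x3 z z1
      refine ⟨w ≫ v.left, ?_⟩
      change (w ≫ v.left) ≫ t.left ≫ k.left = z
      rw [← hw, Category.assoc, reassoc_of% hv']
  · refine ker_iff.2 ⟨?_, ⟨fun a b _ => hT.2.eq_of_tgt _ _⟩, fun W z hz => ⟨0, ?_⟩⟩
    · exact hT.2.eq_zero_of_src _
    · have : z = 0 := by simpa using hz
      rw [this, zero_comp]

/-- Comparison with the abstract reflection. -/
lemma arrow_unit (hC : IsHomological C)
    {Tp Fp : C → Prop} (tt : TorsionTheory C Tp Fp) (hN : TTConditionN Tp Fp)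
    {f G : Arrow C} (η : f ⟶ G) (hG : FreeArrow Fp G)
    (univ : ∀ B : Arrow C, FreeArrow Fp B → ∀ g : f ⟶ B, ∃! h : G ⟶ B, η ≫ h = g)
    {L TL FL : C} {k : L ⟶ f.left} {t : TL ⟶ L} {q : L ⟶ FL}
    (hk : IsKernelOf k f.hom) (hT : Tp TL) (hF : Fp FL) (hs : IsShortExact t q) :
    StrongEpi η.left ∧ IsIso η.right ∧ IsKernelOf (t ≫ k) η.left := by
  obtain ⟨T, Q, t', p, h1, h2, h3, h4, h5, h6⟩ := arrow_ses hC tt hN f hk hT hF hs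
  obtain ⟨c1, c2, c3⟩ := coker_iff.1 h3.isCokernel
  obtain ⟨g, hg, -⟩ := univ Q h2 p
  obtain ⟨h, hh⟩ := c3 η (arrow_hom_zero tt _ h1 hG)
  have i1 : g ≫ h = 𝟙 G := (univ G hG η).unique
    (by rw [← Category.assoc, hg, hh]) (Category.comp_id _)
  have i2 : h ≫ g = 𝟙 Q := by
    rw [← cancel_epi p, ← Category.assoc, hh, hg, Category.comp_id]
  have : IsIso h := ⟨g, i2, i1⟩
  subst hh
  refine ⟨?_, ?_, ?_⟩
  · rw [Arrow.comp_left]; infer_instance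
  · rw [Arrow.comp_right]; infer_instance
  · obtain ⟨k1, k2, k3⟩ := ker_iff.1 h6
    rw [Arrow.comp_left]
    refine ker_iff.2 ⟨by rw [← Category.assoc, k1, zero_comp], k2, fun W z hz => k3 z ?_⟩
    rw [← cancel_mono h.left, Category.assoc, hz, zero_comp]

/-- A `3 × 3` lemma for quotients of split exact sequences. -/
lemma quot_ker (hC : IsHomological C) {X Y Z X' Y' Z' : C}
    {k : X ⟶ Y} {g : Y ⟶ Z} {s : Z ⟶ Y} (h : IsSplitShortExact k g s)
    {k' : X' ⟶ Y'} {g' : Y' ⟶ Z'} {s' : Z' ⟶ Y'}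
    {eX : X ⟶ X'} {eY : Y ⟶ Y'} {eZ : Z ⟶ Z'} [StrongEpi eX] [StrongEpi eY]
    (hk : k ≫ eY = eX ≫ k') (hg : g ≫ eZ = eY ≫ g') (hs : s ≫ eY = eZ ≫ s')
    (H : ∀ ⦃W : C⦄ (z : W ⟶ X), z ≫ k ≫ eY = 0 → z ≫ eX = 0) : IsKernelOf k' g' := by
  obtain ⟨k1, k2, k3⟩ := ker_iff.1 h.isKernel
  have w : k' ≫ g' = 0 := by
    rw [← cancel_epi eX, ← Category.assoc, ← hk, Category.assoc, ← hg, ← Category.assoc, k1,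
      zero_comp, comp_zero]
  obtain ⟨P, p₁, p₂, hP⟩ := exists_pb hC g' eZ
  obtain ⟨m, hm1, hm2⟩ := hP.exists_lift eY g hg.symm
  have hm : StrongEpi m := by
    obtain ⟨I, e, i, he, hi, rfl⟩ := strong_fac hC m
    have : StrongEpi (e ≫ i ≫ p₁) := by
      rw [← Category.assoc, hm1]; infer_instance
    have := strongEpi_of_strongEpi e (i ≫ p₁)
    have : IsIso i := by
      refine short_five hC i p₁ fun W z hz => ⟨z ≫ p₂ ≫ s ≫ e, ?_⟩
      apply hP.hom_ext
      · simp only [Category.assoc] at hm1 ⊢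
        rw [hm1, hs, ← reassoc_of% hP.w, reassoc_of% hz, hz, zero_comp]
      · simp only [Category.assoc] at hm2 ⊢
        rw [hm2, h.split, Category.comp_id]
    infer_instance
  obtain ⟨N, n, hn⟩ := exists_ker hC g'
  obtain ⟨n1, n2, n3⟩ := ker_iff.1 hn
  obtain ⟨c, hc⟩ := n3 k' w
  obtain ⟨n', hn1, hn2⟩ := hP.exists_lift n (0 : N ⟶ Z) (by rw [n1, zero_comp])
  have hpb : IsPullback k (eX ≫ c) m n' := by
    have : Mono k := k2
    refine isPullback_mk ?_ fun W a b hab => ?_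
    · apply hP.hom_ext
      · rw [Category.assoc, Category.assoc, hm1, hn1, Category.assoc, hc, hk]
      · rw [Category.assoc, Category.assoc, hm2, hn2, k1, comp_zero]
    · obtain ⟨l, hl⟩ := k3 a (by
        rw [← hm2, ← Category.assoc, hab, Category.assoc, hn2, comp_zero])
      refine ⟨l, hl, ?_⟩
      rw [← cancel_mono n, Category.assoc, Category.assoc, hc, ← hk, ← Category.assoc, hl, ← hm1,
        ← Category.assoc, hab, Category.assoc, hn1]
  have hst : StrongEpi (eX ≫ c) := strong_pb hC hpb
  obtain ⟨J, j, hj⟩ := exists_ker hC eX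
  obtain ⟨j1, j2, j3⟩ := ker_iff.1 hj
  have hj' : IsKernelOf j (eX ≫ c) := by
    refine ker_iff.2 ⟨by rw [← Category.assoc, j1, zero_comp], j2, fun W z hz => j3 z (H z ?_)⟩
    rw [hk, ← hc]
    rw [reassoc_of% hz, zero_comp]
  have := coker_unique (coker_of_strong hC hj) (coker_of_strong hC hj') c rfl
  refine ker_iff.2 ⟨w, hc ▸ inferInstance, fun W z hz => ?_⟩
  obtain ⟨l, hl⟩ := n3 z hz
  exact ⟨l ≫ inv c, by rw [← hc]; simp [hl]⟩

lemma exists_reflection {Tp Fp : C → Prop} (tt : TorsionTheory C Tp Fp) :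
    ∃ R : Reflection C Fp, NormalEpiUnits R ∧ ∀ A : C, ∃ (TA : C) (t : TA ⟶ A), Tp TA ∧
      IsShortExact t (show A ⟶ R.F.obj A from R.η.app A) := by
  choose TA FA t q hT hF hs using tt.exists_ses
  have he : ∀ A, Epi (q A) := fun A => (coker_iff.1 (hs A).isCokernel).2.1
  have hd : ∀ ⦃A B : C⦄, Fp B → ∀ g : A ⟶ B, ∃ w : FA A ⟶ B, q A ≫ w = g := fun A B hB g =>
    (coker_iff.1 (hs A).isCokernel).2.2 g (tt.hom_zero _ (hT A) hB)
  choose d hd' using hd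
  refine ⟨⟨⟨FA, fun {A B} g => d (hF B) (g ≫ q B), ?_, ?_⟩, ⟨q, ?_⟩, hF, ?_⟩, ?_, ?_⟩
  · intro X
    rw [← cancel_epi (q X), hd']; simp
  · intro X Y Z f g
    rw [← cancel_epi (q X), hd', reassoc_of% hd', Category.assoc, Category.assoc, hd']
  · intro X Y f
    exact (hd' _ _).symm
  · intro X B hB f
    refine ⟨d hB f, hd' _ _, fun y hy => ?_⟩
    rw [← cancel_epi (q X), hd']
    exact hy
  · intro X
    exact ⟨TA X, t X, (hs X).isCokernel⟩
  · intro A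
    exact ⟨TA A, t A, hT A, hs A⟩

lemma arrow_P (hC : IsHomological C)
    {Tp Fp : C → Prop} (tt : TorsionTheory C Tp Fp) (hN : TTConditionN Tp Fp)
    (hP : TTConditionP Tp Fp) : TTConditionP (C := Arrow C) (TorsArrow Tp) (FreeArrow Fp) := by
  intro R _ X Y Z k g s h
  obtain ⟨R₀, hR₀, hses⟩ := exists_reflection tt
  have hpa := hP R₀ hR₀
  choose TA t hT hs using hses
  have ex : ∀ f : Arrow C, ∃ (L : C) (l : L ⟶ f.left), IsKernelOf l f.hom :=
    fun f => exists_ker hC f.hom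
  choose L l hl using ex
  have hu : ∀ f : Arrow C, ∃ η : f ⟶ R.F.obj f, η = R.η.app f ∧ StrongEpi η.left ∧
      IsIso η.right ∧ IsKernelOf (t (L f) ≫ l f) η.left := fun f =>
    ⟨R.η.app f, rfl, arrow_unit hC tt hN (f := f) (R.η.app f) (R.mem f)
      (fun B hB u => R.univ hB u) (hl f) (hT _) (R₀.mem _) (hs _)⟩
  choose η hη hst hiso hker using hu
  have nat : ∀ {f f' : Arrow C} (u : f ⟶ f'), u ≫ η f' = η f ≫ R.F.map u := by
    intro f f' u
    rw [hη, hη]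
    exact R.η.naturality u
  have natl : ∀ {f f' : Arrow C} (u : f ⟶ f'),
      u.left ≫ (η f').left = (η f).left ≫ (R.F.map u).left := by
    intro f f' u
    exact congrArg (fun x => x.left) (nat u)
  have natr : ∀ {f f' : Arrow C} (u : f ⟶ f'),
      u.right ≫ (η f').right = (η f).right ≫ (R.F.map u).right := by
    intro f f' u
    exact congrArg (fun x => x.right) (nat u)
  have hkl := arrow_ker_left h.isKernel
  have hkr := arrow_ker_right h.isKernel
  obtain ⟨a1, a2, a3⟩ := ker_iff.1 hkl
  obtain ⟨b1, b2, b3⟩ := ker_iff.1 hkr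
  have spl : s.left ≫ g.left = 𝟙 _ := congrArg (fun x => x.left) h.split
  -- the induced split exact sequence of kernels
  have ind : ∀ {f f' : Arrow C} (u : f ⟶ f'), ∃ v : L f ⟶ L f', v ≫ l f' = l f ≫ u.left := by
    intro f f' u
    refine (ker_iff.1 (hl f')).2.2 _ ?_
    rw [Category.assoc, Arrow.w, ← Category.assoc, (ker_iff.1 (hl f)).1, zero_comp]
  have hlm : ∀ f, Mono (l f) := fun f => (ker_iff.1 (hl f)).2.1
  obtain ⟨kk, hkk⟩ := ind k
  obtain ⟨gg, hgg⟩ := ind g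
  obtain ⟨ss, hss⟩ := ind s
  have hsplit : IsSplitShortExact kk gg ss := by
    refine ⟨ker_iff.2 ⟨?_, ?_, fun W z hz => ?_⟩, ?_⟩
    · rw [← cancel_mono (l Z), Category.assoc, hgg, reassoc_of% hkk, a1, comp_zero, zero_comp]
    · have : Mono (kk ≫ l Y) := by rw [hkk]; infer_instance
      exact mono_of_mono kk (l Y)
    · obtain ⟨z1, hz1⟩ := a3 (z ≫ l Y) (by
        rw [Category.assoc, ← hgg, reassoc_of% hz, zero_comp])
      obtain ⟨z2, hz2⟩ := (ker_iff.1 (hl X)).2.2 z1 (by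
        rw [← cancel_mono k.right, Category.assoc, ← Arrow.w k, reassoc_of% hz1,
          (ker_iff.1 (hl Y)).1, comp_zero, zero_comp])
      refine ⟨z2, ?_⟩
      rw [← cancel_mono (l Y), Category.assoc, hkk, reassoc_of% hz2, hz1]
    · rw [← cancel_mono (l Z), Category.assoc, hgg, reassoc_of% hss, spl, Category.comp_id,
        Category.id_comp]
  have hmono : Mono (R₀.F.map kk) := (ker_iff.1 (hpa kk gg ss hsplit).isKernel).2.1
  have hsX := hst X
  have hsY := hst Y
  refine ⟨arrow_ker_mk ?_ ?_, by rw [← R.F.map_comp, h.split, R.F.map_id]⟩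
  · refine quot_ker hC ⟨hkl, spl⟩ (natl k) (natl g) (natl s) fun W z hz => ?_
    obtain ⟨w, hw⟩ := (ker_iff.1 (hker Y)).2.2 (z ≫ k.left) (by rw [Category.assoc, hz])
    obtain ⟨z', hz'⟩ := (ker_iff.1 (hl X)).2.2 z (by
      rw [← cancel_mono k.right, Category.assoc, ← Arrow.w k, ← Category.assoc, ← hw,
        Category.assoc, Category.assoc, (ker_iff.1 (hl Y)).1, comp_zero, comp_zero, zero_comp])
    have e1 : z' ≫ kk = w ≫ t (L Y) := by
      rw [← cancel_mono (l Y), Category.assoc, hkk, reassoc_of% hz', Category.assoc, hw]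
    have e2 : z' ≫ R₀.η.app (L X) = 0 := by
      rw [← cancel_mono (R₀.F.map kk)]
      have n := R₀.η.naturality kk
      have t0 := (ker_iff.1 (hs (L Y)).isKernel).1
      calc (z' ≫ R₀.η.app (L X)) ≫ R₀.F.map kk = z' ≫ (R₀.η.app (L X) ≫ R₀.F.map kk) :=
            Category.assoc _ _ _
        _ = z' ≫ (kk ≫ R₀.η.app (L Y)) := by rw [← n]; rfl
        _ = (z' ≫ kk) ≫ R₀.η.app (L Y) := (Category.assoc _ _ _).symm
        _ = w ≫ (t (L Y) ≫ R₀.η.app (L Y)) := by rw [e1]; exact Category.assoc _ _ _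
        _ = 0 := by
          refine (congrArg (fun x => w ≫ x) t0).trans ?_
          exact comp_zero
        _ = 0 ≫ R₀.F.map kk := zero_comp.symm
    obtain ⟨w', hw'⟩ := (ker_iff.1 (hs (L X)).isKernel).2.2 z' e2
    rw [← hz', ← hw', Category.assoc, Category.assoc, ← Category.assoc (t _),
      (ker_iff.1 (hker X)).1, comp_zero]
  · have i1 := hiso X
    have i2 := hiso Y
    have i3 := hiso Z
    have ek : (R.F.map k).right = inv (η X).right ≫ k.right ≫ (η Y).right := by
      rw [natr k]; simp
    have eg : (R.F.map g).right = inv (η Y).right ≫ g.right ≫ (η Z).right := by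
      rw [natr g]; simp
    rw [ek, eg]
    refine ker_iff.2 ⟨by simp [reassoc_of% b1], inferInstance, fun W z hz => ?_⟩
    obtain ⟨w, hw⟩ := b3 (z ≫ inv (η Y).right) (by
      rw [← cancel_mono (η Z).right]; simpa using hz)
    exact ⟨w ≫ (η X).right, by simp [reassoc_of% hw]⟩

end Main

/-- Proposition 4.3. Let `C` be homological and `(Tp, Fp)` a torsion
theory in `C` satisfying condition (N). Then the pair `(T₁, F₁)` is a torsion theory in
the arrow category satisfying condition (N), where `F₁` consists of the arrows whose
kernel lies in `Fp` and `T₁` of the arrows of the form `T ⟶ 0` with `T ∈ Tp`. If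
`(Tp, Fp)` moreover satisfies condition (P), then so does `(T₁, F₁)`. -/
theorem statement16 {C : Type u} [Category.{v} C] [HasZeroObject C] [HasZeroMorphisms C]
    (hC : IsHomological C) {Tp Fp : C → Prop} (tt : TorsionTheory C Tp Fp)
    (hN : TTConditionN Tp Fp) :
    TorsionTheory (Arrow C)
        (fun g => Tp g.left ∧ IsZero g.right)
        (fun g => ∃ (K : C) (k : K ⟶ g.left), IsKernelOf k g.hom ∧ Fp K)
      ∧ TTConditionN (C := Arrow C)
          (fun g => Tp g.left ∧ IsZero g.right)
          (fun g => ∃ (K : C) (k : K ⟶ g.left), IsKernelOf k g.hom ∧ Fp K)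
      ∧ (TTConditionP Tp Fp →
          TTConditionP (C := Arrow C)
            (fun g => Tp g.left ∧ IsZero g.right)
            (fun g => ∃ (K : C) (k : K ⟶ g.left), IsKernelOf k g.hom ∧ Fp K)) := by
  exact ⟨arrow_tt hC tt hN, arrow_N hC tt hN, arrow_P hC tt hN⟩

end ProtoPaper
end
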